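/- Strong Brown–Deligne theorem for cyclotomic MZV's: for every N ∈ ℕ and w ∈ ℕ, the set {Li(𝛆;𝔰) : 𝔰 ∈ S_w, 𝛆 ∈ Γ_N^{depth(𝔰)}} spans the K_N-vector space CZ_{N,w}. -/

import Mathlib

noncomputable section

open scoped Classical

namespace ZHPC

variable (Fq : Type) [Field Fq] [Fintype Fq]

/-- `q`, the cardinality of the base finite field `𝔽_q`. -/
def qc : ℕ := Fintype.card Fq

/-- A fixed algebraic closure `𝔽̄_q` of `𝔽_q`. -/
abbrev Fb := AlgebraicClosure Fq

/-- The field `𝔽̄_q((1/θ))` of formal Laurent series in `1/θ` over `𝔽̄_q`, modeled as the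
field of formal Laurent series in one variable, `θ` being the inverse of that variable. -/
abbrev Kinf := LaurentSeries (Fb Fq)

/-- The embedding of the constants `𝔽̄_q → 𝔽̄_q((1/θ))`. -/
def cst : Fb Fq →+* Kinf Fq := HahnSeries.C

/-- The element `θ`. -/
def theta : Kinf Fq := HahnSeries.single (-1 : ℤ) 1

/-- `ℓ_d = ∏_{i=1}^{d} (θ - θ^{q^i})`, with `ℓ_0 = 1`. -/
def ell (d : ℕ) : Kinf Fq := ∏ i ∈ Finset.Icc 1 d, (theta Fq - theta Fq ^ qc Fq ^ i)

/-- Arrays `(𝛆;𝔰)` of some depth `n`. -/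
structure PArr (F : Type) where
  depth : ℕ
  s : Fin depth → ℕ
  eps : Fin depth → F

namespace PArr

variable {F : Type}

/-- A *positive array* for level `N`: all entries `sᵢ` are positive integers and all the
characters `εᵢ` are `N`-th roots of unity. -/
def Positive [Monoid F] (N : ℕ) (A : PArr F) : Prop := (∀ i, 0 < A.s i) ∧ ∀ i, A.eps i ^ N = 1

/-- The weight `w(𝔰) = s₁ + ⋯ + s_n`. -/
def wt (A : PArr F) : ℕ := ∑ i, A.s i

/-- The `i`-th entry of `𝔰` (`0`-indexed), with value `0` beyond the depth. -/
def sAt (A : PArr F) (i : ℕ) : ℕ := if h : i < A.depth then A.s ⟨i, h⟩ else 0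

/-- The partial sums `s₁ + ⋯ + s_i` (entries beyond the depth being `0`). -/
def psum (A : PArr F) (i : ℕ) : ℕ := ∑ j ∈ Finset.range i, A.sAt j

/-- The character `χ(𝛆) = ε₁ ⋯ ε_n`. -/
def chi [CommMonoid F] (A : PArr F) : F := ∏ i, A.eps i

end PArr

/-- The Carlitz multiple polylogarithm at roots of unity
`Li(𝛆;𝔰) = Σ_{d₁ > ⋯ > d_n ≥ 0} ε₁^{d₁}⋯ε_n^{d_n} / (ℓ_{d₁}^{s₁}⋯ℓ_{d_n}^{s_n})`. -/
def Li (A : PArr (Fb Fq)) : Kinf Fq :=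
  ∑' d : {f : Fin A.depth → ℕ // StrictAnti f},
    ∏ i, cst Fq (A.eps i ^ d.1 i) / ell Fq (d.1 i) ^ A.s i

/-- `Si_d(𝛆;𝔰)`: same summand as `Li`, over decreasing tuples with `d₁ = d`. -/
def Sid (d : ℤ) (A : PArr (Fb Fq)) : Kinf Fq :=
  ∑' f : {f : Fin A.depth → ℕ // StrictAnti f ∧ ∀ i : Fin A.depth, i.val = 0 → (f i : ℤ) = d},
    ∏ i, cst Fq (A.eps i ^ f.1 i) / ell Fq (f.1 i) ^ A.s i

/-- `Si_{<d}(𝛆;𝔰)`: same summand as `Li`, over decreasing tuples with `d > d₁`. -/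
def SidLt (d : ℤ) (A : PArr (Fb Fq)) : Kinf Fq :=
  ∑' f : {f : Fin A.depth → ℕ // StrictAnti f ∧ ∀ i : Fin A.depth, (f i : ℤ) < d},
    ∏ i, cst Fq (A.eps i ^ f.1 i) / ell Fq (f.1 i) ^ A.s i

/-- The value at `θ` of the monic polynomial `θ^e + Σ_{j<e} c_j θ^j ∈ A = 𝔽_q[θ]`. -/
def monicVal (e : ℕ) (c : Fin e → Fq) : Kinf Fq :=
  theta Fq ^ e + ∑ j, cst Fq (algebraMap Fq (Fb Fq) (c j)) * theta Fq ^ (j : ℕ)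

/-- The power sum `S_d(𝛆;𝔰)`, a sum over tuples of monic polynomials `a₁, …, a_n ∈ A₊`
with `d = deg a₁ > ⋯ > deg a_n ≥ 0`; a monic polynomial of degree `e` is encoded by its
tuple of lower coefficients `c : Fin e → Fq`. -/
def Sd (d : ℤ) (A : PArr (Fb Fq)) : Kinf Fq :=
  ∑' e : {f : Fin A.depth → ℕ // StrictAnti f ∧ ∀ i : Fin A.depth, i.val = 0 → (f i : ℤ) = d},
    ∑ c : (∀ i, Fin (e.1 i) → Fq),
      ∏ i, cst Fq (A.eps i ^ e.1 i) / monicVal Fq (e.1 i) (c i) ^ A.s i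

/-- The `N`-th cyclotomic multiple zeta value `ζ_A(𝛆;𝔰) = Σ_{d ≥ 0} S_d(𝛆;𝔰)`. -/
def zetaA (A : PArr (Fb Fq)) : Kinf Fq := ∑' d : ℕ, Sd Fq (d : ℤ) A

/-- The cyclotomic field `k_N = 𝔽_q(ζ_N) ⊆ 𝔽̄_q`. -/
def kN (N : ℕ) : Subfield (Fb Fq) :=
  Subfield.closure (Set.range (algebraMap Fq (Fb Fq)) ∪ {x | x ^ N = 1})

/-- The field `K_N = k_N(θ)`, as a subfield of `𝔽̄_q((1/θ))`. -/
def KNf (N : ℕ) : Subfield (Kinf Fq) :=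
  Subfield.closure ((cst Fq '' (kN Fq N : Set (Fb Fq))) ∪ {theta Fq})

/-- The ring `A_N = k_N[θ]`, as a subring of `𝔽̄_q((1/θ))`. -/
def AN (N : ℕ) : Subring (Kinf Fq) :=
  Subring.closure ((cst Fq '' (kN Fq N : Set (Fb Fq))) ∪ {theta Fq})

/-- `CZ_{N,w}`: the `K_N`-span of the `N`-th cyclotomic multiple zeta values of weight `w`. -/
def CZ (N w : ℕ) : Submodule (KNf Fq N) (Kinf Fq) :=
  Submodule.span (KNf Fq N) {x | ∃ A : PArr (Fb Fq), A.Positive N ∧ A.wt = w ∧ x = zetaA Fq A}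

/-- `CL_{N,w}`: the `K_N`-span of the CMPL's at `N`-th roots of unity of weight `w`. -/
def CL (N w : ℕ) : Submodule (KNf Fq N) (Kinf Fq) :=
  Submodule.span (KNf Fq N) {x | ∃ A : PArr (Fb Fq), A.Positive N ∧ A.wt = w ∧ x = Li Fq A}

/-- The index set of pairs `(𝔰,𝛆)` with `𝔰 ∈ S_w` and `𝛆 ∈ Γ_N^{depth 𝔰}`: positive arrays
of weight `w` with `q ∤ sᵢ` for all `i`. -/
def SwIdx (N w : ℕ) : Type :=
  {A : PArr (Fb Fq) // A.Positive N ∧ 0 < A.depth ∧ A.wt = w ∧ ∀ i, ¬ qc Fq ∣ A.s i}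

set_option synthInstance.maxHeartbeats 1000000


section part1

section gen
variable {X L : Type*} [Field L]

/-- summation operator -/
def gSg (g : ℕ → L) (d : ℕ) : L := ∑ j ∈ Finset.range d, g j

/-- iterated sums -/
def gFF (τ : X → ℕ → L) : List X → ℕ → L
  | [] => 1
  | x :: u => gSg (τ x * gFF τ u)

/-- iterated sums with top index fixed -/
def gGG (τ : X → ℕ → L) : List X → ℕ → L
  | [] => 0
  | x :: u => τ x * gFF τ u

/-- letter function -/
def gt {F : Type*} [Field F] (c : F →+* L) (ell : ℕ → L) (x : F × ℕ) (d : ℕ) : L :=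
  c (x.1 ^ d) / ell d ^ x.2

/-- admissible letter -/
def okL {F : Type*} [Field F] (N : ℕ) (x : F × ℕ) : Prop := 0 < x.2 ∧ x.1 ^ N = 1

/-- admissible word of weight w -/
def IsW {F : Type*} [Field F] (N w : ℕ) (u : List (F × ℕ)) : Prop :=
  (∀ x ∈ u, okL N x) ∧ (u.map Prod.snd).sum = w

lemma gSg_zero : gSg (0 : ℕ → L) = 0 := by funext d; simp [gSg]

lemma gSg_add (a b : ℕ → L) : gSg (a + b) = gSg a + gSg b := by
  funext d; simp [gSg, Finset.sum_add_distrib]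

lemma gSg_smul {R : Type*} [CommRing R] [Algebra R L] (r : R) (a : ℕ → L) :
    gSg (r • a) = r • gSg a := by
  funext d; simp [gSg, Finset.smul_sum]

lemma gSg_mul (a b : ℕ → L) : gSg a * gSg b = gSg (a * gSg b + b * gSg a + a * b) := by
  funext d
  induction d with
  | zero => simp [gSg]
  | succ d ih =>
    simp only [Pi.mul_apply, gSg, Finset.sum_range_succ, Pi.add_apply] at ih ⊢
    rw [← ih]; ring

lemma gSg_GG (τ : X → ℕ → L) (u : List X) (hu : u ≠ []) : gSg (gGG τ u) = gFF τ u := by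
  cases u with
  | nil => exact absurd rfl hu
  | cons x u => rfl

lemma gFF_succ (τ : X → ℕ → L) (u : List X) (d : ℕ) :
    gFF τ u (d + 1) = gFF τ u d + gGG τ u d := by
  cases u with
  | nil => simp [gFF, gGG]
  | cons x u => simp [gFF, gGG, gSg, Finset.sum_range_succ]

end gen

section alg
variable {F L R : Type*} [Field F] [Field L] [CommRing R] [Algebra R L]

lemma gt_mul (c : F →+* L) (ell : ℕ → L) (x y : F × ℕ) :
    gt c ell x * gt c ell y = gt c ell (x.1 * y.1, x.2 + y.2) := by
  funext d
  simp only [Pi.mul_apply, gt, mul_pow, map_mul, pow_add]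
  rw [div_mul_div_comm]

lemma IsW.nil {N : ℕ} : IsW N 0 ([] : List (F × ℕ)) := by simp [IsW]

lemma IsW.cons {N w : ℕ} {x : F × ℕ} {u : List (F × ℕ)} (hx : okL N x) (hu : IsW N w u) :
    IsW N (x.2 + w) (x :: u) := by
  refine ⟨?_, by simp [hu.2]⟩
  intro y hy
  rcases List.mem_cons.1 hy with rfl | h
  · exact hx
  · exact hu.1 y h

lemma okL.mul {N : ℕ} {x y : F × ℕ} (hx : okL N x) (hy : okL N y) :
    okL N (x.1 * y.1, x.2 + y.2) :=
  ⟨Nat.add_pos_left hx.1 _, by simp [mul_pow, hx.2, hy.2]⟩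

variable (R) in
/-- span of the `gFF` -/
def spF (c : F →+* L) (ell : ℕ → L) (N w : ℕ) : Submodule R (ℕ → L) :=
  Submodule.span R {f | ∃ u, IsW N w u ∧ f = gFF (gt c ell) u}

variable (R) in
/-- span of the `gGG` -/
def spG (c : F →+* L) (ell : ℕ → L) (N w : ℕ) : Submodule R (ℕ → L) :=
  Submodule.span R {f | ∃ u, IsW N w u ∧ f = gGG (gt c ell) u}

variable {c : F →+* L} {ell : ℕ → L} {N : ℕ}

lemma FF_mem {w : ℕ} {u : List (F × ℕ)} (hu : IsW N w u) :
    gFF (gt c ell) u ∈ spF R c ell N w := Submodule.subset_span ⟨u, hu, rfl⟩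

lemma GG_mem {w : ℕ} {u : List (F × ℕ)} (hu : IsW N w u) :
    gGG (gt c ell) u ∈ spG R c ell N w := Submodule.subset_span ⟨u, hu, rfl⟩

lemma t_mul_mem {w : ℕ} {x : F × ℕ} (hx : okL N x) {f : ℕ → L} (hf : f ∈ spF R c ell N w) :
    gt c ell x * f ∈ spG R c ell N (x.2 + w) := by
  induction hf using Submodule.span_induction with
  | mem f hf =>
    obtain ⟨u, hu, rfl⟩ := hf
    exact GG_mem (u := x :: u) (hu.cons hx)
  | zero => rw [mul_zero]; exact zero_mem _
  | add a b _ _ ha hb => rw [mul_add]; exact add_mem ha hb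
  | smul r a _ ha => rw [mul_smul_comm]; exact Submodule.smul_mem _ _ ha

lemma Sg_mem {w : ℕ} {f : ℕ → L} (hf : f ∈ spG R c ell N w) :
    gSg f ∈ spF R c ell N w := by
  induction hf using Submodule.span_induction with
  | mem f hf =>
    obtain ⟨u, hu, rfl⟩ := hf
    by_cases h : u = []
    · subst h
      rw [show gGG (gt c ell) [] = 0 from rfl, gSg_zero]; exact zero_mem _
    · rw [gSg_GG _ _ h]; exact FF_mem hu
  | zero => rw [gSg_zero]; exact zero_mem _
  | add a b _ _ ha hb => rw [gSg_add]; exact add_mem ha hb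
  | smul r a _ ha => rw [gSg_smul]; exact Submodule.smul_mem _ _ ha

lemma IsW.of_cons {w : ℕ} {x : F × ℕ} {u : List (F × ℕ)} (h : IsW N w (x :: u)) :
    okL N x ∧ ∃ w', w = x.2 + w' ∧ IsW N w' u := by
  refine ⟨h.1 x (by simp), (u.map Prod.snd).sum, ?_, fun y hy => h.1 y (by simp [hy]), rfl⟩
  rw [← h.2]; simp

lemma FF_mul_FF : ∀ (n : ℕ) (u v : List (F × ℕ)) (a b : ℕ), u.length + v.length ≤ n →
    IsW N a u → IsW N b v →
    gFF (gt c ell) u * gFF (gt c ell) v ∈ spF R c ell N (a + b) := by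
  intro n
  induction n with
  | zero =>
    intro u v a b hn hu hv
    have hu0 : u = [] := List.length_eq_zero_iff.1 (by omega)
    subst hu0
    rw [show gFF (gt c ell) [] = 1 from rfl, one_mul]
    have : a = 0 := by rw [← hu.2]; simp
    rw [this, zero_add]; exact FF_mem hv
  | succ n ih =>
    intro u v a b hn hu hv
    cases u with
    | nil =>
      rw [show gFF (gt c ell) [] = 1 from rfl, one_mul]
      have : a = 0 := by rw [← hu.2]; simp
      rw [this, zero_add]; exact FF_mem hv
    | cons x u =>
      cases v with
      | nil =>
        rw [show gFF (gt c ell) [] = 1 from rfl, mul_one]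
        have : b = 0 := by rw [← hv.2]; simp
        rw [this, add_zero]; exact FF_mem hu
      | cons y v =>
        obtain ⟨hx, a', rfl, hu'⟩ := hu.of_cons
        obtain ⟨hy, b', rfl, hv'⟩ := hv.of_cons
        simp only [List.length_cons] at hn
        have h1 := t_mul_mem hx (ih u (y :: v) a' (y.2 + b') (by simp; omega) hu' hv)
        have h2 := t_mul_mem hy (ih v (x :: u) b' (x.2 + a') (by simp; omega) hv' hu)
        have h3 := t_mul_mem (hx.mul hy) (ih u v a' b' (by omega) hu' hv')
        rw [show gFF (gt c ell) (x :: u) * gFF (gt c ell) (y :: v) =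
          gSg (gt c ell x * gFF (gt c ell) u) * gSg (gt c ell y * gFF (gt c ell) v) from rfl,
          gSg_mul]
        apply Sg_mem
        refine add_mem (add_mem ?_ ?_) ?_
        · convert h1 using 1
          · congr 1; omega
          · rw [mul_assoc]; rfl
        · convert h2 using 1
          · congr 1; omega
          · rw [mul_assoc]; rfl
        · convert h3 using 1
          · congr 1; simp only; omega
          · rw [← gt_mul]; ring

lemma spF_mul {a b : ℕ} {f g : ℕ → L} (hf : f ∈ spF R c ell N a) (hg : g ∈ spF R c ell N b) :
    f * g ∈ spF R c ell N (a + b) := by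
  have : spF R c ell N a * spF R c ell N b ≤ spF R c ell N (a + b) := by
    rw [spF, spF, Submodule.span_mul_span, Submodule.span_le]
    rintro _ ⟨_, ⟨u, hu, rfl⟩, _, ⟨v, hv, rfl⟩, rfl⟩
    exact FF_mul_FF _ u v a b le_rfl hu hv
  exact this (Submodule.mul_mem_mul hf hg)

lemma spG_mul_spF {a b : ℕ} {f g : ℕ → L} (hf : f ∈ spG R c ell N a)
    (hg : g ∈ spF R c ell N b) : f * g ∈ spG R c ell N (a + b) := by
  have : spG R c ell N a * spF R c ell N b ≤ spG R c ell N (a + b) := by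
    rw [spG, spF, Submodule.span_mul_span, Submodule.span_le]
    rintro _ ⟨_, ⟨u, hu, rfl⟩, _, ⟨v, hv, rfl⟩, rfl⟩
    cases u with
    | nil => simp [gGG]
    | cons x u =>
      obtain ⟨hx, a', rfl, hu'⟩ := hu.of_cons
      have := t_mul_mem hx (FF_mul_FF (R := R) (c := c) (ell := ell) _ u v a' b le_rfl hu' hv)
      simp only [gGG]
      rw [mul_assoc, add_assoc]; exact this
  exact this (Submodule.mul_mem_mul hf hg)

lemma spG_mul {a b : ℕ} {f g : ℕ → L} (hf : f ∈ spG R c ell N a)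
    (hg : g ∈ spG R c ell N b) : f * g ∈ spG R c ell N (a + b) := by
  have : spG R c ell N a * spG R c ell N b ≤ spG R c ell N (a + b) := by
    rw [spG, spG, Submodule.span_mul_span, Submodule.span_le]
    rintro _ ⟨_, ⟨u, hu, rfl⟩, _, ⟨v, hv, rfl⟩, rfl⟩
    cases u with
    | nil => simp [gGG]
    | cons x u =>
      cases v with
      | nil => simp [gGG]
      | cons y v =>
        obtain ⟨hx, a', rfl, hu'⟩ := hu.of_cons
        obtain ⟨hy, b', rfl, hv'⟩ := hv.of_cons
        have := t_mul_mem (hx.mul hy)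
          (FF_mul_FF (R := R) (c := c) (ell := ell) _ u v a' b' le_rfl hu' hv')
        simp only [gGG, SetLike.mem_coe]
        convert this using 1
        · congr 1; simp only; omega
        · rw [← gt_mul]; ring
  exact this (Submodule.mul_mem_mul hf hg)

/-- multiplication by a character -/
lemma chi_mul_mem {w : ℕ} {e : F} (he : e ^ N = 1) {f : ℕ → L} (hf : f ∈ spG R c ell N w) :
    gt c ell (e, 0) * f ∈ spG R c ell N w := by
  induction hf using Submodule.span_induction with
  | mem f hf =>
    obtain ⟨u, hu, rfl⟩ := hf
    cases u with
    | nil => simp [gGG]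
    | cons x u =>
      obtain ⟨hx, a', rfl, hu'⟩ := hu.of_cons
      have h2 : okL N (e * x.1, x.2) := ⟨hx.1, by simp [mul_pow, he, hx.2]⟩
      have := GG_mem (R := R) (c := c) (ell := ell) (hu'.cons h2)
      convert this using 1
      simp only [gGG]
      rw [← mul_assoc, gt_mul]; simp
  | zero => rw [mul_zero]; exact zero_mem _
  | add a b _ _ ha hb => rw [mul_add]; exact add_mem ha hb
  | smul r a _ ha => rw [mul_smul_comm]; exact Submodule.smul_mem _ _ ha

lemma spG_mono_one {w : ℕ} : spG R c ell 1 w ≤ spG R c ell N w := by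
  apply Submodule.span_mono
  rintro _ ⟨u, hu, rfl⟩
  exact ⟨u, ⟨fun x hx => ⟨(hu.1 x hx).1, by have := (hu.1 x hx).2; rw [pow_one] at this; simp [this]⟩, hu.2⟩, rfl⟩

/-- iterated sums with other letters -/
lemma FF_other_mem (τ : F × ℕ → ℕ → L) (hτ : ∀ x, okL N x → τ x ∈ spG R c ell N x.2)
    (u : List (F × ℕ)) : ∀ w, IsW N w u → gFF τ u ∈ spF R c ell N w := by
  induction u with
  | nil =>
    intro w hu
    have : gFF τ [] = gFF (gt c ell) [] := rfl
    rw [this]; exact FF_mem hu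
  | cons x u ih =>
    intro w hu
    obtain ⟨hx, a', rfl, hu'⟩ := hu.of_cons
    exact Sg_mem (spG_mul_spF (hτ x hx) (ih _ hu'))

lemma GG_other_mem (τ : F × ℕ → ℕ → L) (hτ : ∀ x, okL N x → τ x ∈ spG R c ell N x.2)
    (u : List (F × ℕ)) (w : ℕ) (hu : IsW N w u) : gGG τ u ∈ spG R c ell N w := by
  cases u with
  | nil => exact zero_mem _
  | cons x u =>
    obtain ⟨hx, a', rfl, hu'⟩ := hu.of_cons
    exact spG_mul_spF (hτ x hx) (FF_other_mem τ hτ u _ hu')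

lemma FF_congr {X : Type*} (τ τ' : X → ℕ → L) (u : List X) (h : ∀ x ∈ u, τ x = τ' x) :
    gFF τ u = gFF τ' u := by
  induction u with
  | nil => rfl
  | cons x u ih =>
    simp only [gFF]
    rw [h x (by simp), ih (fun y hy => h y (by simp [hy]))]

lemma GG_congr {X : Type*} (τ τ' : X → ℕ → L) (u : List X) (h : ∀ x ∈ u, τ x = τ' x) :
    gGG τ u = gGG τ' u := by
  cases u with
  | nil => rfl
  | cons x u =>
    simp only [gGG]
    rw [h x (by simp), FF_congr τ τ' u (fun y hy => h y (by simp [hy]))]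

end alg

end part1

section part2

open Filter Topology

/-- basic data on `ell` -/
structure EllData {L : Type*} [Field L] (q : ℕ) (θ : L) (ell : ℕ → L) : Prop where
  zero : ell 0 = 1
  succ : ∀ d, ell (d + 1) = ell d * (θ - θ ^ q ^ (d + 1))
  ne : ∀ d, ell d ≠ 0
  frob : ∀ x y : L, (x - y) ^ q = x ^ q - y ^ q
  q2 : 2 ≤ q

section rel
variable {F L R : Type*} [Field F] [Field L] [CommRing R] [Algebra R L]
  {c : F →+* L} {ell : ℕ → L} {N q : ℕ} {θ : L}

lemma EllData.d1_ne (h : EllData q θ ell) : θ ^ q - θ ≠ 0 := by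
  intro h0
  apply h.ne 1
  rw [h.succ 0, h.zero, pow_add, pow_zero, pow_one, one_mul, one_mul]
  linear_combination -h0

lemma EllData.sum_eq (h : EllData q θ ell) (d : ℕ) :
    (θ ^ q - θ) * ell d ^ q * ∑ j ∈ Finset.range (d + 1), 1 / ell j ^ (q - 1) = - ell (d + 1) := by
  induction d with
  | zero => simp [h.zero, h.succ 0]
  | succ d ih =>
    rw [Finset.sum_range_succ, mul_add]
    have e1 : ell (d + 1) ^ q = ell d ^ q * (θ ^ q - θ ^ q ^ (d + 2)) := by
      rw [h.succ d, mul_pow, h.frob, ← pow_mul, ← pow_succ]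
    have e2 : ell (d + 1) ^ q * (1 / ell (d + 1) ^ (q - 1)) = ell (d + 1) := by
      have := h.ne (d + 1)
      have hq : q = (q - 1) + 1 := by have := h.q2; omega
      conv_lhs => rw [hq, pow_succ]
      simp only [Nat.add_sub_cancel]
      field_simp
    rw [h.succ (d + 1), mul_assoc, mul_assoc, e2]
    rw [← mul_assoc, e1]
    linear_combination (θ ^ q - θ ^ q ^ (d + 2)) * ih

lemma EllData.rel (h : EllData q θ ell) (e : F) (he : e ≠ 0) (d : ℕ) :
    gt c ell (e, q) d = (θ ^ q - θ) * (- c e⁻¹) * gGG (gt c ell) [(e, 1), (1, q - 1)] (d + 1) := by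
  have h1 := h.sum_eq d
  have h2 := h.ne d
  have h3 := h.ne (d + 1)
  have hce : c e ≠ 0 := by simpa using he
  have : gFF (gt c ell) [(1, q - 1)] (d + 1) = ∑ j ∈ Finset.range (d + 1), 1 / ell j ^ (q - 1) := by
    simp [gFF, gSg, gt]
  simp only [gGG, Pi.mul_apply, this]
  simp only [gt, pow_one, map_pow, map_inv₀]
  field_simp
  field_simp at h1
  linear_combination (c e ^ (d + 1)) * h1

/-- prefix operator -/
def gP {X : Type*} (τ : X → ℕ → L) : List X → (ℕ → L) → ℕ → L
  | [], g => gSg g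
  | x :: p, g => gSg (τ x * gP τ p g)

lemma FF_append {X : Type*} (τ : X → ℕ → L) (p : List X) (y : X) (u : List X) :
    gFF τ (p ++ y :: u) = gP τ p (gGG τ (y :: u)) := by
  induction p with
  | nil => rfl
  | cons x p ih => simp only [List.cons_append, gFF, gP, ih]

lemma gP_add {X : Type*} (τ : X → ℕ → L) (p : List X) (a b : ℕ → L) :
    gP τ p (a + b) = gP τ p a + gP τ p b := by
  induction p with
  | nil => simp [gP, gSg_add]
  | cons x p ih => simp only [gP, ih, mul_add, gSg_add]

lemma gP_smul {X : Type*} (τ : X → ℕ → L) (p : List X) (r : R) (b : ℕ → L) :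
    gP τ p (r • b) = r • gP τ p b := by
  induction p with
  | nil => simp [gP, gSg_smul]
  | cons x p ih => simp only [gP, ih, mul_smul_comm, gSg_smul]

lemma gP_shift {w : ℕ} {h : ℕ → L} (hh : h ∈ spG R c ell N w) (h0 : h 0 = 0)
    (p : List (F × ℕ)) : ∀ a, IsW N a p →
    gP (gt c ell) p (fun d => h (d + 1)) ∈ spF R c ell N (a + w) ⊔ spG R c ell N (a + w) := by
  induction p with
  | nil =>
    intro a ha
    have ha0 : a = 0 := by rw [← ha.2]; simp
    subst ha0
    rw [zero_add]
    have : gP (gt c ell) [] (fun d => h (d + 1)) = gSg h + h := by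
      funext d
      simp only [gP, gSg, Pi.add_apply]
      rw [← Finset.sum_range_succ, Finset.sum_range_succ', h0, add_zero]
    rw [this]
    exact Submodule.add_mem_sup (Sg_mem hh) hh
  | cons x p ih =>
    intro a ha
    obtain ⟨hx, a', rfl, hp⟩ := ha.of_cons
    apply Submodule.mem_sup_left
    simp only [gP]
    apply Sg_mem
    obtain ⟨f, hf, g, hg, hfg⟩ := Submodule.mem_sup.1 (ih a' hp)
    rw [← hfg, mul_add]
    refine add_mem ?_ ?_
    · rw [add_assoc]; exact t_mul_mem hx hf
    · have h1 : gt c ell x ∈ spG R c ell N x.2 := by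
        have := GG_mem (R := R) (c := c) (ell := ell) (IsW.nil.cons hx)
        simpa [gGG, gFF] using this
      rw [add_assoc]; exact spG_mul h1 hg

lemma IsW.append {a b : ℕ} {u v : List (F × ℕ)} (hu : IsW N a u) (hv : IsW N b v) :
    IsW N (a + b) (u ++ v) := by
  refine ⟨?_, by simp [hu.2, hv.2]⟩
  intro x hx
  rcases List.mem_append.1 hx with h | h
  · exact hu.1 x h
  · exact hv.1 x h

section top
variable [TopologicalSpace L] [IsTopologicalRing L] [T2Space L]

/-- functions having a limit in `P` -/
def limT (P : Submodule R L) : Submodule R (ℕ → L) where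
  carrier := {f | ∃ m ∈ P, Tendsto f atTop (𝓝 m)}
  zero_mem' := ⟨0, zero_mem _, tendsto_const_nhds⟩
  add_mem' := by
    rintro a b ⟨m, hm, h1⟩ ⟨m', hm', h2⟩
    exact ⟨m + m', add_mem hm hm', h1.add h2⟩
  smul_mem' := by
    rintro r a ⟨m, hm, h1⟩
    refine ⟨r • m, P.smul_mem r hm, ?_⟩
    have : (r • a) = fun d => algebraMap R L r * a d := by
      funext d; simp [Algebra.smul_def]
    rw [this, Algebra.smul_def]
    exact h1.const_mul _

variable (R) in
/-- span of the limits -/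
def spL (LL : List (F × ℕ) → L) (N w : ℕ) : Submodule R L :=
  Submodule.span R {x | ∃ u, IsW N w u ∧ x = LL u}

/-- limit data -/
structure LimData (c : F →+* L) (ell : ℕ → L) (N : ℕ) (LL : List (F × ℕ) → L) : Prop where
  hF : ∀ u, (∀ x ∈ u, okL N x) → Tendsto (gFF (gt c ell) u) atTop (𝓝 (LL u))
  hG : ∀ u, (∀ x ∈ u, okL N x) → Tendsto (gGG (gt c ell) u) atTop (𝓝 0)

variable {LL : List (F × ℕ) → L}

lemma sp_le_limT (H : LimData c ell N LL) (w : ℕ) :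
    spF R c ell N w ⊔ spG R c ell N w ≤ limT (spL R LL N w) := by
  apply sup_le
  · apply Submodule.span_le.2
    rintro _ ⟨u, hu, rfl⟩
    exact ⟨LL u, Submodule.subset_span ⟨u, hu, rfl⟩, H.hF u hu.1⟩
  · apply Submodule.span_le.2
    rintro _ ⟨u, hu, rfl⟩
    exact ⟨0, zero_mem _, H.hG u hu.1⟩

/-- the key relation in the limit -/
lemma key_rel (H : LimData c ell N LL) (E : EllData q θ ell) (hN : 0 < N)
    {δ : R} (hδ : algebraMap R L δ = θ ^ q - θ)
    (hR : ∀ e : F, e ^ N = 1 → ∃ r : R, algebraMap R L r = c e)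
    {a b : ℕ} {p v : List (F × ℕ)} (hp : IsW N a p) (hv : IsW N b v) {e : F} (he : e ^ N = 1) :
    ∃ m ∈ spL R LL N (a + (q + b)), Tendsto
      (gP (gt c ell) p (gt c ell (e, q) * gFF (gt c ell) v + gt c ell (e, q) * gGG (gt c ell) v))
      atTop (𝓝 (δ • m)) := by
  have he0 : e ≠ 0 := by rintro rfl; rw [zero_pow hN.ne'] at he; exact zero_ne_one he
  obtain ⟨r, hr⟩ := hR e⁻¹ (by rw [inv_pow, he, inv_one])
  have hq := E.q2
  have ho1 : okL N (e, 1) := ⟨one_pos, he⟩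
  have ho2 : okL N ((1 : F), q - 1) := ⟨by simp; omega, one_pow _⟩
  set h : ℕ → L := gGG (gt c ell) [(e, 1), (1, q - 1)] * gFF (gt c ell) v with hh
  have hm : h ∈ spG R c ell N (q + b) := by
    have := spG_mul_spF (R := R) (c := c) (ell := ell)
      (GG_mem ((IsW.nil.cons ho2).cons ho1)) (FF_mem hv)
    convert this using 2
    simp only; omega
  have h0 : h 0 = 0 := by simp [hh, gGG, gFF, gSg]
  have e1 : gt c ell (e, q) * gFF (gt c ell) v + gt c ell (e, q) * gGG (gt c ell) v
      = δ • ((-r) • fun d => h (d + 1)) := by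
    funext d
    have e2 : (δ • ((-r) • fun d => h (d + 1))) d =
        algebraMap R L δ * (algebraMap R L (-r) * h (d + 1)) := by
      simp only [Pi.smul_apply, Algebra.smul_def (A := L)]
    rw [e2, hδ, map_neg, hr]
    simp only [Pi.add_apply, Pi.mul_apply, hh, gFF_succ]
    rw [E.rel e he0]
    ring
  obtain ⟨m, hm1, hm2⟩ := sp_le_limT (R := R) H _ (gP_shift hm h0 p a hp)
  refine ⟨(-r) • m, Submodule.smul_mem _ _ hm1, ?_⟩
  rw [e1, gP_smul, gP_smul]
  have : ∀ (s : R) (f : ℕ → L) (m : L), Tendsto f atTop (𝓝 m) → Tendsto (s • f) atTop (𝓝 (s • m)) := by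
    intro s f m hf
    have : (s • f) = fun d => algebraMap R L s * f d := by
      funext d; simp [Algebra.smul_def]
    rw [this, Algebra.smul_def]
    exact hf.const_mul _
  exact this _ _ _ (this _ _ _ hm2)

lemma rel_end (H : LimData c ell N LL) (E : EllData q θ ell) (hN : 0 < N)
    {δ : R} (hδ : algebraMap R L δ = θ ^ q - θ)
    (hR : ∀ e : F, e ^ N = 1 → ∃ r : R, algebraMap R L r = c e)
    {w : ℕ} {p : List (F × ℕ)} {e : F} (hw : IsW N w (p ++ [(e, q)])) :
    LL (p ++ [(e, q)]) ∈ Ideal.span {δ} • spL R LL N w := by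
  have he : e ^ N = 1 := (hw.1 (e, q) (by simp)).2
  have hp : IsW N (p.map Prod.snd).sum p := ⟨fun x hx => hw.1 x (by simp [hx]), rfl⟩
  obtain ⟨m, hm, hl⟩ := key_rel H E hN hδ hR hp IsW.nil he
  have h2 : Tendsto (gFF (gt c ell) (p ++ [(e, q)])) atTop (𝓝 (δ • m)) := by
    rw [FF_append]
    convert hl using 2
    simp [gGG]
  rw [tendsto_nhds_unique (H.hF _ hw.1) h2]
  have hww : (p.map Prod.snd).sum + (q + 0) = w := by rw [← hw.2]; simp
  rw [hww] at hm
  exact Submodule.smul_mem_smul (Ideal.mem_span_singleton_self δ) hm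

lemma rel_merge (H : LimData c ell N LL) (E : EllData q θ ell) (hN : 0 < N)
    {δ : R} (hδ : algebraMap R L δ = θ ^ q - θ)
    (hR : ∀ e : F, e ^ N = 1 → ∃ r : R, algebraMap R L r = c e)
    {w : ℕ} {p v : List (F × ℕ)} {e : F} {y : F × ℕ} (hw : IsW N w (p ++ (e, q) :: y :: v)) :
    LL (p ++ (e, q) :: y :: v) + LL (p ++ (e * y.1, q + y.2) :: v)
      ∈ Ideal.span {δ} • spL R LL N w := by
  have he : e ^ N = 1 := (hw.1 (e, q) (by simp)).2
  have hp : IsW N (p.map Prod.snd).sum p := ⟨fun x hx => hw.1 x (by simp [hx]), rfl⟩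
  have hv : IsW N (y.2 + (v.map Prod.snd).sum) (y :: v) :=
    ⟨fun x hx => hw.1 x (by simp only [List.mem_append, List.mem_cons] at hx ⊢; tauto), by simp⟩
  have hy : okL N y := hw.1 y (by simp)
  obtain ⟨m, hm, hl⟩ := key_rel H E hN hδ hR hp hv he
  have hu2 : ∀ x ∈ p ++ (e * y.1, q + y.2) :: v, okL N x := by
    intro x hx
    rcases List.mem_append.1 hx with h | h
    · exact hw.1 x (by simp [h])
    · rcases List.mem_cons.1 h with rfl | h
      · exact okL.mul (hw.1 (e, q) (by simp)) hy
      · exact hw.1 x (by simp [h])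
  have h2 : Tendsto (gFF (gt c ell) (p ++ (e, q) :: y :: v) +
      gFF (gt c ell) (p ++ (e * y.1, q + y.2) :: v)) atTop (𝓝 (δ • m)) := by
    rw [FF_append, FF_append, ← gP_add]
    have e1 : gGG (gt c ell) ((e * y.1, q + y.2) :: v) = gt c ell (e, q) * gGG (gt c ell) (y :: v) := by
      simp only [gGG]
      rw [← mul_assoc, gt_mul]
    rw [e1]
    exact hl
  rw [tendsto_nhds_unique ((H.hF _ hw.1).add (H.hF _ hu2)) h2]
  have hww : (p.map Prod.snd).sum + (q + (y.2 + (v.map Prod.snd).sum)) = w := by rw [← hw.2]; simp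
  rw [hww] at hm
  exact Submodule.smul_mem_smul (Ideal.mem_span_singleton_self δ) hm

variable (R) in
/-- span of the limits of words with letters satisfying a condition -/
def spLc (LL : List (F × ℕ) → L) (P : ℕ → Prop) (N w : ℕ) : Submodule R L :=
  Submodule.span R {x | ∃ u, IsW N w u ∧ (∀ x ∈ u, P x.2) ∧ x = LL u}

lemma wt_eq_of {w : ℕ} {p v : List (F × ℕ)} {e : F} {y : F × ℕ} :
    (p ++ (e, q) :: y :: v |>.map Prod.snd).sum = w ↔
     (p ++ (e * y.1, q + y.2) :: v |>.map Prod.snd).sum = w := by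
  simp [add_assoc]

lemma IsW.merge {w : ℕ} {p v : List (F × ℕ)} {e : F} {y : F × ℕ}
    (hw : IsW N w (p ++ (e, q) :: y :: v)) : IsW N w (p ++ (e * y.1, q + y.2) :: v) := by
  refine ⟨?_, wt_eq_of.1 hw.2⟩
  intro x hx
  rcases List.mem_append.1 hx with h | h
  · exact hw.1 x (by simp [h])
  · rcases List.mem_cons.1 h with rfl | h
    · exact okL.mul (hw.1 (e, q) (by simp)) (hw.1 y (by simp))
    · exact hw.1 x (by simp [h])

lemma IsW.split {w s : ℕ} (hq : 0 < q) (hs : q < s) {p v : List (F × ℕ)} {e : F}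
    (hw : IsW N w (p ++ (e, s) :: v)) : IsW N w (p ++ (1, q) :: (e, s - q) :: v) := by
  refine ⟨?_, ?_⟩
  · intro x hx
    simp only [List.mem_append, List.mem_cons] at hx
    rcases hx with h | rfl | rfl | h
    · exact hw.1 x (by simp [h])
    · exact ⟨hq, one_pow _⟩
    · exact ⟨by simp; omega, (hw.1 (e, s) (by simp)).2⟩
    · exact hw.1 x (by simp [h])
  · rw [← hw.2]; simp; omega

/-- the measure -/
def mu (u : List (F × ℕ)) : ℕ := (u.map fun x => 2 * x.2 - 1).sum

lemma spanT_aux (H : LimData c ell N LL) (E : EllData q θ ell) (hN : 0 < N)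
    {δ : R} (hδ : algebraMap R L δ = θ ^ q - θ)
    (hR : ∀ e : F, e ^ N = 1 → ∃ r : R, algebraMap R L r = c e) {w : ℕ} :
    ∀ (n : ℕ) (p v : List (F × ℕ)), mu v ≤ n → (∀ x ∈ p, x.2 ≤ q) → IsW N w (p ++ v) →
      LL (p ++ v) ∈ spLc R LL (· ≤ q) N w ⊔ Ideal.span {δ} • spL R LL N w := by
  intro n
  have hq := E.q2
  induction n with
  | zero =>
    intro p v hn hp hw
    cases v with
    | nil =>
      apply Submodule.mem_sup_left
      exact Submodule.subset_span ⟨_, hw, by simpa using hp, rfl⟩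
    | cons x v =>
      have := (hw.1 x (by simp)).1
      simp [mu] at hn
      omega
  | succ n ih =>
    intro p v hn hp hw
    cases v with
    | nil =>
      apply Submodule.mem_sup_left
      exact Submodule.subset_span ⟨_, hw, by simpa using hp, rfl⟩
    | cons x v =>
      have hx := (hw.1 x (by simp)).1
      by_cases hs : x.2 ≤ q
      · have := ih (p ++ [x]) v (by simp [mu] at hn ⊢; omega)
          (by
            intro y hy
            simp only [List.mem_append, List.mem_singleton] at hy
            rcases hy with h | rfl
            · exact hp y h
            · exact hs) (by simpa using hw)
        simpa using this
      · obtain ⟨e, s⟩ := x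
        simp only at hs hx
        have hw2 := hw.split (q := q) (by omega) (by omega)
        have h1 := rel_merge H E hN hδ hR hw2
        rw [one_mul, show q + (s - q) = s by omega] at h1
        have h2 := ih (p ++ [(1, q)]) ((e, s - q) :: v) (by simp [mu] at hn ⊢; omega)
          (by
            intro y hy
            simp only [List.mem_append, List.mem_singleton] at hy
            rcases hy with h | rfl
            · exact hp y h
            · exact le_rfl) (by simpa using hw2)
        rw [List.append_assoc, List.singleton_append] at h2
        have h3 := sub_mem (Submodule.mem_sup_right (S := spLc R LL (· ≤ q) N w) h1) h2
        simpa using h3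

lemma spanS_aux (H : LimData c ell N LL) (E : EllData q θ ell) (hN : 0 < N)
    {δ : R} (hδ : algebraMap R L δ = θ ^ q - θ)
    (hR : ∀ e : F, e ^ N = 1 → ∃ r : R, algebraMap R L r = c e) {w : ℕ} :
    ∀ (n : ℕ) (p v : List (F × ℕ)), mu p ≤ n → (∀ x ∈ v, ¬ q ∣ x.2) → IsW N w (p ++ v) →
      LL (p ++ v) ∈ spLc R LL (fun s => ¬ q ∣ s) N w ⊔ Ideal.span {δ} • spL R LL N w := by
  intro n
  have hq := E.q2
  induction n with
  | zero =>
    intro p v hn hp hw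
    cases p with
    | nil =>
      apply Submodule.mem_sup_left
      exact Submodule.subset_span ⟨_, hw, by simpa using hp, rfl⟩
    | cons x p =>
      have := (hw.1 x (by simp)).1
      simp [mu] at hn
      omega
  | succ n ih =>
    intro p v hn hv hw
    rcases List.eq_nil_or_concat p with rfl | ⟨p, x, rfl⟩
    · apply Submodule.mem_sup_left
      exact Submodule.subset_span ⟨_, hw, by simpa using hv, rfl⟩
    · simp only [List.concat_eq_append, List.append_assoc, List.singleton_append] at hw hn ⊢
      have hx := (hw.1 x (by simp)).1
      by_cases hs : q ∣ x.2
      · obtain ⟨e, s⟩ := x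
        simp only at hs hx
        by_cases hsq : s = q
        · subst hsq
          cases v with
          | nil =>
            apply Submodule.mem_sup_right
            exact rel_end H E hN hδ hR hw
          | cons y v =>
            have h1 := rel_merge H E hN hδ hR hw
            have h2 := ih p ((e * y.1, s + y.2) :: v) (by simp [mu] at hn ⊢; omega)
              (by
                intro z hz
                rcases List.mem_cons.1 hz with rfl | h
                · have := hv y (by simp)
                  simpa using this
                · exact hv z (by simp [h])) hw.merge
            have h3 := sub_mem (Submodule.mem_sup_right (S := spLc R LL (fun i => ¬ s ∣ i) N w) h1) h2
            simpa using h3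
        · have hlt : q < s := lt_of_le_of_ne (Nat.le_of_dvd hx hs) (Ne.symm hsq)
          have hw2 := hw.split (q := q) (by omega) hlt
          have h1 := rel_merge H E hN hδ hR hw2
          rw [one_mul, show q + (s - q) = s by omega] at h1
          have h2 := ih (p ++ [(1, q), (e, s - q)]) v (by simp [mu] at hn ⊢; omega) hv
            (by simpa using hw2)
          rw [List.append_assoc] at h2
          simp only [List.cons_append, List.nil_append] at h2
          have h3 := sub_mem (Submodule.mem_sup_right (S := spLc R LL (fun s => ¬ q ∣ s) N w) h1) h2
          simpa using h3
      · refine ih p (x :: v) (by simp [mu] at hn ⊢; omega) ?_ hw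
        intro y hy
        rcases List.mem_cons.1 hy with rfl | h
        · exact hs
        · exact hv y h

end top
end rel

lemma finite_words {F : Type*} [Field F] {N : ℕ} (hN : 0 < N) (w : ℕ) :
    {u : List (F × ℕ) | IsW N w u}.Finite := by
  have hA : {x : F × ℕ | x.1 ^ N = 1 ∧ x.2 ≤ w}.Finite := by
    have h1 : {e : F | e ^ N = 1}.Finite := by
      have : {e : F | e ^ N = 1} ⊆ ↑(Polynomial.nthRoots N (1 : F)).toFinset := by
        intro e he
        simp only [Finset.mem_coe, Multiset.mem_toFinset]
        exact (Polynomial.mem_nthRoots hN).2 he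
      exact (Finset.finite_toSet _).subset this
    exact (h1.prod (Set.finite_Iic w)).subset (fun x hx => ⟨hx.1, hx.2⟩)
  have := hA.to_subtype
  have h2 := List.finite_length_le {x : F × ℕ | x.1 ^ N = 1 ∧ x.2 ≤ w} w
  refine (h2.image (List.map Subtype.val)).subset ?_
  intro u hu
  have hle : ∀ x ∈ u, x.2 ≤ w := by
    intro x hx
    rw [← hu.2]
    exact List.le_sum_of_mem (List.mem_map_of_mem hx)
  have hlen : u.length ≤ w := by
    have : (u.map Prod.snd).length ≤ (u.map Prod.snd).sum := by
      apply List.length_le_sum_of_one_le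
      intro i hi
      obtain ⟨x, hx, rfl⟩ := List.mem_map.1 hi
      exact (hu.1 x hx).1
    rw [hu.2] at this
    simpa using this
  refine ⟨u.attach.map (fun x => ⟨x.1, (hu.1 x.1 x.2).2, hle x.1 x.2⟩), by simpa only [Set.mem_setOf_eq, List.length_map, List.length_attach] using hlen, ?_⟩
  rw [List.map_map]
  exact List.attach_map_subtype_val u

section nak
variable {F L R : Type*} [Field F] [Field L] [CommRing R] [Algebra R L]
  [TopologicalSpace L] [IsTopologicalRing L] [T2Space L]
  {c : F →+* L} {ell : ℕ → L} {N q : ℕ} {θ : L} {LL : List (F × ℕ) → L}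

lemma nak_aux (hN : 0 < N) {δ : R} (w : ℕ) (P : Submodule R L)
    (h : spL R LL N w ≤ P ⊔ Ideal.span {δ} • spL R LL N w) :
    ∃ y : R, ∀ x ∈ spL R LL N w, (1 + δ * y) • x ∈ P := by
  have hfg : (spL R LL N w).FG := by
    apply Submodule.fg_span
    refine ((finite_words (F := F) hN w).image LL).subset ?_
    rintro _ ⟨u, hu, rfl⟩
    exact ⟨u, hu, rfl⟩
  obtain ⟨r, hr, hrP⟩ := Submodule.exists_sub_one_mem_and_smul_le_of_fg_of_le_sup hfg le_rfl h
  obtain ⟨y, hy⟩ := Ideal.mem_span_singleton'.1 hr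
  refine ⟨y, fun x hx => ?_⟩
  have : 1 + δ * y = r := by linear_combination hy
  rw [this]
  exact hrP (Submodule.smul_mem_pointwise_smul x r _ hx)

lemma spanT (H : LimData c ell N LL) (E : EllData q θ ell) (hN : 0 < N)
    {δ : R} (hδ : algebraMap R L δ = θ ^ q - θ)
    (hR : ∀ e : F, e ^ N = 1 → ∃ r : R, algebraMap R L r = c e) (w : ℕ) :
    ∃ y : R, ∀ x ∈ spL R LL N w, (1 + δ * y) • x ∈ spLc R LL (· ≤ q) N w := by
  apply nak_aux hN
  apply Submodule.span_le.2
  rintro _ ⟨u, hu, rfl⟩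
  exact spanT_aux H E hN hδ hR _ [] u le_rfl (by simp) hu

lemma spanS (H : LimData c ell N LL) (E : EllData q θ ell) (hN : 0 < N)
    {δ : R} (hδ : algebraMap R L δ = θ ^ q - θ)
    (hR : ∀ e : F, e ^ N = 1 → ∃ r : R, algebraMap R L r = c e) (w : ℕ) :
    ∃ y : R, ∀ x ∈ spL R LL N w, (1 + δ * y) • x ∈ spLc R LL (fun s => ¬ q ∣ s) N w := by
  apply nak_aux hN
  apply Submodule.span_le.2
  rintro _ ⟨u, hu, rfl⟩
  have := spanS_aux H E hN hδ hR _ u [] le_rfl (by simp) (by simpa using hu)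
  simpa using this

end nak

end part2

section part3
open Polynomial

section carlitz
variable {k L : Type*} [Field k] [Fintype k] [Field L] [Algebra k L]

lemma frob_add' {A : Type*} [CommRing A] [Algebra k A] (x y : A) :
    (x + y) ^ Fintype.card k = x ^ Fintype.card k + y ^ Fintype.card k := by
  simpa using map_add (FiniteField.frobeniusAlgHom k A) x y

lemma frob_sub' {A : Type*} [CommRing A] [Algebra k A] (x y : A) :
    (x - y) ^ Fintype.card k = x ^ Fintype.card k - y ^ Fintype.card k := by
  simpa using map_sub (FiniteField.frobeniusAlgHom k A) x y

lemma frob_sum' {A ι : Type*} [CommRing A] [Algebra k A] (s : Finset ι) (f : ι → A) :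
    (∑ i ∈ s, f i) ^ Fintype.card k = ∑ i ∈ s, f i ^ Fintype.card k := by
  exact map_sum (FiniteField.frobeniusAlgHom k A) f s

lemma frob_pow_add {A : Type*} [CommRing A] [Algebra k A] (i : ℕ) (x y : A) :
    (x + y) ^ Fintype.card k ^ i = x ^ Fintype.card k ^ i + y ^ Fintype.card k ^ i := by
  induction i with
  | zero => simp
  | succ i ih => rw [pow_succ, pow_mul, ih, frob_add' (k := k), ← pow_mul, ← pow_mul]

lemma frob_pow_sub {A : Type*} [CommRing A] [Algebra k A] (i : ℕ) (x y : A) :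
    (x - y) ^ Fintype.card k ^ i = x ^ Fintype.card k ^ i - y ^ Fintype.card k ^ i := by
  induction i with
  | zero => simp
  | succ i ih => rw [pow_succ, pow_mul, ih, frob_sub' (k := k), ← pow_mul, ← pow_mul]

variable (k) in
/-- Carlitz factorials -/
def cD (θ : L) : ℕ → L
  | 0 => 1
  | i + 1 => (θ ^ Fintype.card k ^ (i + 1) - θ) * cD θ i ^ Fintype.card k

variable (k) in
/-- coefficients -/
def cc (θ : L) (ell : ℕ → L) (i d : ℕ) : L :=
  if i ≤ d then 1 / (cD k θ i * ell (d - i) ^ Fintype.card k ^ i) else 0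

variable (k) in
/-- Carlitz polynomial function -/
def psi (θ : L) (ell : ℕ → L) (d : ℕ) (x : L) : L :=
  ∑ i ∈ Finset.range (d + 1), cc k θ ell i d * x ^ Fintype.card k ^ i

variable {θ : L} {ell : ℕ → L}

lemma cD_ne (hb : ∀ i, θ ^ Fintype.card k ^ (i + 1) - θ ≠ 0) (i : ℕ) : cD k θ i ≠ 0 := by
  induction i with
  | zero => simp [cD]
  | succ i ih => exact mul_ne_zero (hb i) (pow_ne_zero _ ih)

lemma br_ne (E : EllData (Fintype.card k) θ ell) (i : ℕ) : θ ^ Fintype.card k ^ (i + 1) - θ ≠ 0 := by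
  intro h
  apply E.ne (i + 1)
  rw [E.succ]
  rw [show θ - θ ^ Fintype.card k ^ (i + 1) = 0 by linear_combination -h, mul_zero]

lemma cc_r2 (E : EllData (Fintype.card k) θ ell) (i d : ℕ) :
    cc k θ ell (i + 1) (d + 1) * (θ ^ Fintype.card k ^ (i + 1) - θ)
      = cc k θ ell i d ^ Fintype.card k := by
  have hb := br_ne E i
  have hD := cD_ne (br_ne E) i
  simp only [cc, Nat.add_le_add_iff_right]
  split_ifs with h
  · rw [show d + 1 - (i + 1) = d - i by omega, cD]
    have := E.ne (d - i)
    rw [div_pow, mul_pow, ← pow_mul, ← pow_succ, one_pow]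
    field_simp
  · have := E.q2
    rw [zero_mul, zero_pow (by omega)]

lemma cc_r1_zero (E : EllData (Fintype.card k) θ ell) (d : ℕ) :
    cc k θ ell 0 (d + 1) * (θ ^ Fintype.card k ^ (d + 1) - θ) = - cc k θ ell 0 d := by
  have hb := br_ne E d
  have h1 := E.ne d
  have h2 := E.ne (d + 1)
  simp only [cc, Nat.zero_le, if_true, cD, Nat.sub_zero, pow_zero, pow_one, one_mul]
  field_simp
  rw [E.succ]; ring

lemma cc_r1_succ (E : EllData (Fintype.card k) θ ell) (i d : ℕ) :
    cc k θ ell (i + 1) (d + 1) * (θ ^ Fintype.card k ^ (d + 1) - θ)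
      = cc k θ ell i d ^ Fintype.card k - cc k θ ell (i + 1) d := by
  rw [← cc_r2 E]
  have hb := br_ne E i
  have hD := cD_ne (br_ne E) (i + 1)
  by_cases h : i + 1 ≤ d
  · have h' : i + 1 ≤ d + 1 := by omega
    simp only [cc, h, h', if_true]
    have h1 := E.ne (d - (i + 1))
    have h2 := E.ne (d + 1 - (i + 1))
    have e1 : d + 1 - (i + 1) = (d - (i + 1)) + 1 := by omega
    have e2 : ell (d + 1 - (i + 1)) ^ Fintype.card k ^ (i + 1) =
       ell (d - (i + 1)) ^ Fintype.card k ^ (i + 1) *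
        (θ ^ Fintype.card k ^ (i + 1) - θ ^ Fintype.card k ^ (d + 1)) := by
      rw [e1, E.succ, mul_pow, frob_pow_sub (k := k), ← pow_mul, ← pow_add]
      congr 4; omega
    have h3 : (θ ^ Fintype.card k ^ (i + 1) - θ ^ Fintype.card k ^ (d + 1)) ≠ 0 := by
      intro h0
      rw [h0, mul_zero] at e2
      exact pow_ne_zero _ h2 e2
    rw [e2]
    field_simp
    ring
  · have h2 : cc k θ ell (i + 1) d = 0 := by simp [cc, h]
    rw [h2, sub_zero]
    by_cases h3 : i = d
    · rw [h3]
    · have : cc k θ ell (i + 1) (d + 1) = 0 := by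
        simp only [cc]; rw [if_neg (by omega)]
      rw [this]; simp

lemma psi_frob (d : ℕ) (x : L) : psi k θ ell d x ^ Fintype.card k =
    ∑ i ∈ Finset.range (d + 1), cc k θ ell i d ^ Fintype.card k * x ^ Fintype.card k ^ (i + 1) := by
  rw [psi, frob_sum']
  refine Finset.sum_congr rfl fun i _ => ?_
  rw [mul_pow, ← pow_mul, ← pow_succ]

lemma psi_r1 (E : EllData (Fintype.card k) θ ell) (d : ℕ) (x : L) :
    psi k θ ell (d + 1) x * (θ ^ Fintype.card k ^ (d + 1) - θ)
      = psi k θ ell d x ^ Fintype.card k - psi k θ ell d x := by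
  rw [psi_frob]
  have e : psi k θ ell d x = ∑ i ∈ Finset.range (d + 2), cc k θ ell i d * x ^ Fintype.card k ^ i := by
    rw [Finset.sum_range_succ, psi]
    simp [cc]
  have h1 := Finset.sum_range_succ' (fun i => cc k θ ell i d * x ^ Fintype.card k ^ i) (d + 1)
  have h2 := Finset.sum_range_succ' (fun i => cc k θ ell i (d + 1) * x ^ Fintype.card k ^ i) (d + 1)
  have h3 : (∑ i ∈ Finset.range (d + 1), cc k θ ell (i + 1) (d + 1) * x ^ Fintype.card k ^ (i + 1))
      * (θ ^ Fintype.card k ^ (d + 1) - θ) =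
      ∑ i ∈ Finset.range (d + 1), cc k θ ell i d ^ Fintype.card k * x ^ Fintype.card k ^ (i + 1)
      - ∑ i ∈ Finset.range (d + 1), cc k θ ell (i + 1) d * x ^ Fintype.card k ^ (i + 1) := by
    rw [Finset.sum_mul, ← Finset.sum_sub_distrib]
    refine Finset.sum_congr rfl fun i _ => ?_
    rw [← sub_mul, ← cc_r1_succ E]; ring
  have h4 := cc_r1_zero E d
  rw [e, psi, h1, h2, add_mul, h3]
  linear_combination x ^ Fintype.card k ^ 0 * h4

lemma psi_r2 (E : EllData (Fintype.card k) θ ell) (d : ℕ) (x : L) :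
    psi k θ ell (d + 1) (θ * x)
      = θ * psi k θ ell (d + 1) x + psi k θ ell d x ^ Fintype.card k := by
  rw [psi_frob, psi, psi, Finset.sum_range_succ', Finset.sum_range_succ' _ (d + 1), mul_add,
    add_right_comm, Finset.mul_sum, ← Finset.sum_add_distrib]
  congr 1
  · refine Finset.sum_congr rfl fun i _ => ?_
    rw [← cc_r2 E]; ring
  · simp; ring

lemma psi_add (d : ℕ) (x y : L) :
    psi k θ ell d (x + y) = psi k θ ell d x + psi k θ ell d y := by
  simp only [psi, ← Finset.sum_add_distrib]
  refine Finset.sum_congr rfl fun i _ => ?_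
  rw [frob_pow_add]; ring

lemma psi_zero (d : ℕ) : psi k θ ell d 0 = 0 := by
  have := psi_add (k := k) (θ := θ) (ell := ell) d 0 0
  simpa using this

lemma psi_const (d : ℕ) (a : k) (x : L) :
    psi k θ ell d (algebraMap k L a * x) = algebraMap k L a * psi k θ ell d x := by
  simp only [psi, Finset.mul_sum]
  refine Finset.sum_congr rfl fun i _ => ?_
  rw [mul_pow, ← map_pow, FiniteField.pow_card_pow]; ring

lemma psi_sum {ι : Type*} (d : ℕ) (s : Finset ι) (f : ι → L) :
    psi k θ ell d (∑ i ∈ s, f i) = ∑ i ∈ s, psi k θ ell d (f i) := by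
  induction s using Finset.induction_on with
  | empty => simp [psi_zero]
  | insert a s ha ih => rw [Finset.sum_insert ha, Finset.sum_insert ha, psi_add, ih]

lemma psi_theta (E : EllData (Fintype.card k) θ ell) (d : ℕ) :
    psi k θ ell d (θ ^ d) = 1 ∧ ∀ j < d, psi k θ ell d (θ ^ j) = 0 := by
  have hq := E.q2
  induction d with
  | zero => simp [psi, cc, cD, E.zero]
  | succ d ih =>
    have h2 : ∀ j < d + 1, psi k θ ell (d + 1) (θ ^ j) = 0 := by
      intro j hj
      have h := psi_r1 E d (θ ^ j)
      rcases Nat.lt_succ_iff_lt_or_eq.1 hj with h3 | rfl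
      · rw [ih.2 j h3, zero_pow (by omega), sub_zero] at h
        exact (mul_eq_zero.1 h).resolve_right (br_ne E d)
      · rw [ih.1, one_pow, sub_self] at h
        exact (mul_eq_zero.1 h).resolve_right (br_ne E j)
    refine ⟨?_, h2⟩
    rw [pow_succ', psi_r2 E, h2 d (by omega), ih.1]; simp

/-- monic value -/
def mv (θ : L) (d : ℕ) (a : Fin d → k) : L := θ ^ d + ∑ j, algebraMap k L (a j) * θ ^ (j : ℕ)

lemma psi_low (E : EllData (Fintype.card k) θ ell) (d : ℕ) (a : Fin d → k) :
    psi k θ ell d (∑ j, algebraMap k L (a j) * θ ^ (j : ℕ)) = 0 := by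
  rw [psi_sum]
  apply Finset.sum_eq_zero
  intro j _
  rw [psi_const, (psi_theta E d).2 j j.2, mul_zero]

lemma psi_mv (E : EllData (Fintype.card k) θ ell) (d : ℕ) (a : Fin d → k) :
    psi k θ ell d (mv θ d a) = 1 := by
  rw [mv, psi_add, psi_low E, (psi_theta E d).1, add_zero]

lemma mv_ne (E : EllData (Fintype.card k) θ ell) (d : ℕ) (a : Fin d → k) : mv θ d a ≠ 0 := by
  intro h
  have := psi_mv E d a
  rw [h, psi_zero] at this
  exact zero_ne_one this

lemma mv_inj (htr : Function.Injective (aeval θ : k[X] → L)) (d : ℕ) :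
    Function.Injective (mv (k := k) θ d) := by
  intro a b hab
  have h : ∀ a : Fin d → k, aeval θ (∑ j, C (a j) * X ^ (j : ℕ) : k[X]) =
      ∑ j, algebraMap k L (a j) * θ ^ (j : ℕ) := by
    intro a; simp
  have h2 : (∑ j, C (a j) * X ^ (j : ℕ) : k[X]) = ∑ j, C (b j) * X ^ (j : ℕ) := by
    apply htr
    rw [h, h]
    exact add_left_cancel hab
  funext i
  have h3 : ∀ a : Fin d → k, (∑ j, C (a j) * X ^ (j : ℕ) : k[X]).coeff i = a i := by
    intro a
    simp only [finset_sum_coeff, coeff_C_mul, coeff_X_pow]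
    rw [Finset.sum_eq_single i]
    · simp
    · intro j _ hj
      rw [if_neg (fun h => hj (Fin.ext h.symm)), mul_zero]
    · simp
  rw [← h3 a, h2, h3]

variable (k) in
/-- the quotient polynomial -/
def Qa (θ : L) (ell : ℕ → L) (d : ℕ) (a : L) : L[X] :=
  ∑ i ∈ Finset.range (d + 1), C (cc k θ ell i d) * (C a - X) ^ (Fintype.card k ^ i - 1)

lemma Qa_mul (d : ℕ) (a : L) (ha : psi k θ ell d a = 1) :
    (C a - X) * Qa k θ ell d a =
      1 - ∑ i ∈ Finset.range (d + 1), C (cc k θ ell i d) * X ^ (Fintype.card k ^ i) := by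
  have h1 : (1 : L[X]) = ∑ i ∈ Finset.range (d + 1), C (cc k θ ell i d) * (C a) ^ (Fintype.card k ^ i) := by
    rw [← C_1, ← ha, psi, map_sum]
    simp
  conv_rhs => rw [h1]
  rw [Qa, Finset.mul_sum, ← Finset.sum_sub_distrib]
  refine Finset.sum_congr rfl fun i _ => ?_
  have hpos : 0 < Fintype.card k ^ i := pow_pos Fintype.card_pos _
  rw [← mul_sub, ← frob_pow_sub (k := k), mul_left_comm, ← pow_succ', Nat.sub_add_cancel hpos]

lemma sum_Qa (E : EllData (Fintype.card k) θ ell)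
    (htr : Function.Injective (aeval θ : k[X] → L)) (d : ℕ) :
    ∑ a : Fin d → k, Qa k θ ell d (mv θ d a) = C (cc k θ ell 0 d) := by
  have hq := E.q2
  set s : Finset L := Finset.univ.image (mv (k := k) θ d) with hs
  have hcard : s.card = Fintype.card k ^ d := by
    rw [hs, Finset.card_image_of_injective _ (mv_inj htr d)]
    simp
  have hdeg : ∀ a : L, (Qa k θ ell d a).degree < s.card := by
    intro a
    rw [hcard]
    rw [Qa]
    refine lt_of_le_of_lt (degree_sum_le _ _) ?_
    rw [Finset.sup_lt_iff (by exact WithBot.bot_lt_coe _)]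
    intro i hi
    have hpos : 0 < Fintype.card k ^ i := pow_pos Fintype.card_pos _
    have h1 : natDegree (C (cc k θ ell i d) * (C a - X) ^ (Fintype.card k ^ i - 1))
        ≤ Fintype.card k ^ i - 1 := by
      refine (natDegree_C_mul_le _ _).trans ?_
      refine natDegree_pow_le.trans ?_
      have : natDegree (C a - X : L[X]) ≤ 1 := by
        refine (natDegree_sub_le _ _).trans ?_
        simp
      nlinarith
    have h2 : Fintype.card k ^ i ≤ Fintype.card k ^ d :=
      Nat.pow_le_pow_right Fintype.card_pos (by simpa [Nat.lt_succ_iff] using hi)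
    refine lt_of_le_of_lt degree_le_natDegree ?_
    exact_mod_cast (by omega : natDegree (C (cc k θ ell i d) * (C a - X) ^ (Fintype.card k ^ i - 1)) < Fintype.card k ^ d)
  apply Polynomial.eq_of_degrees_lt_of_eval_finset_eq s
  · refine lt_of_le_of_lt (degree_sum_le _ _) ?_
    rw [Finset.sup_lt_iff (by exact WithBot.bot_lt_coe _)]
    intro a _
    exact hdeg _
  · refine lt_of_le_of_lt degree_C_le ?_
    rw [hcard]
    exact_mod_cast pow_pos Fintype.card_pos _
  · intro x hx
    obtain ⟨b, -, rfl⟩ := Finset.mem_image.1 hx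
    rw [eval_finset_sum, eval_C, Finset.sum_eq_single b]
    · rw [Qa, eval_finset_sum, Finset.sum_range_succ', Finset.sum_eq_zero]
      · simp
      · intro i _
        have : Fintype.card k ^ (i + 1) - 1 ≠ 0 := by
          have : 1 < Fintype.card k ^ (i + 1) := Nat.one_lt_pow (by omega) (by omega)
          omega
        simp [this]
    · intro a _ hab
      have hne : mv θ d a - mv θ d b ≠ 0 := sub_ne_zero.2 fun h => hab (mv_inj htr d h)
      have h0 := congrArg (eval (mv θ d b)) (Qa_mul d (mv θ d a) (psi_mv E d a))
      have h1 := psi_mv E d b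
      rw [psi] at h1
      simp only [eval_mul, eval_sub, eval_C, eval_X, eval_one, eval_finset_sum, eval_pow] at h0
      rw [h1, sub_self] at h0
      exact (mul_eq_zero.1 h0).resolve_left hne
    · simp

variable (k) in
/-- power sums -/
def pS (θ : L) (n d : ℕ) : L := ∑ a : Fin d → k, 1 / mv θ d a ^ n

lemma pS_ps (E : EllData (Fintype.card k) θ ell)
    (htr : Function.Injective (aeval θ : k[X] → L)) (d : ℕ) :
    (1 - ∑ i ∈ Finset.range (d + 1), PowerSeries.C (cc k θ ell i d) *
      PowerSeries.X ^ (Fintype.card k ^ i)) * PowerSeries.mk (fun n => pS k θ (n + 1) d)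
      = PowerSeries.C (cc k θ ell 0 d) := by
  have h1 : PowerSeries.mk (fun n => pS k θ (n + 1) d) =
      ∑ a : Fin d → k, PowerSeries.mk (fun n => 1 / mv θ d a ^ (n + 1)) := by
    ext n; simp [pS]
  have h2 : ∀ a : Fin d → k, (PowerSeries.C (mv θ d a) - PowerSeries.X) *
      PowerSeries.mk (fun n => 1 / mv θ d a ^ (n + 1)) = 1 := by
    intro a
    have hne := mv_ne E d a
    ext n
    rw [sub_mul, map_sub, PowerSeries.coeff_C_mul]
    cases n with
    | zero => simp [hne]
    | succ n =>
      rw [PowerSeries.coeff_succ_X_mul]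
      simp only [PowerSeries.coeff_mk, PowerSeries.coeff_one]
      rw [if_neg (by omega)]
      field_simp
      ring
  have h3 : ∀ a : Fin d → k, (1 - ∑ i ∈ Finset.range (d + 1), PowerSeries.C (cc k θ ell i d) *
      PowerSeries.X ^ (Fintype.card k ^ i)) =
      (PowerSeries.C (mv θ d a) - PowerSeries.X) * (Qa k θ ell d (mv θ d a) : PowerSeries L) := by
    intro a
    have := congrArg (Polynomial.coeToPowerSeries.ringHom) (Qa_mul d (mv θ d a) (psi_mv E d a))
    simp only [map_mul, map_sub, map_one, map_sum, map_pow] at this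
    simpa using this.symm
  rw [h1, Finset.mul_sum]
  rw [Finset.sum_congr rfl fun a _ => by rw [h3 a, mul_right_comm, h2 a, one_mul]]
  have := congrArg (Polynomial.coeToPowerSeries.ringHom) (sum_Qa E htr d)
  simpa using this

lemma pS_one (E : EllData (Fintype.card k) θ ell)
    (htr : Function.Injective (aeval θ : k[X] → L)) (d : ℕ) :
    pS k θ 1 d = 1 / ell d := by
  have := congrArg (PowerSeries.coeff 0) (pS_ps E htr d)
  have hz : ∀ i, ¬ Fintype.card k ^ i = 0 := fun i => pow_ne_zero _ Fintype.card_ne_zero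
  rw [sub_mul, map_sub, one_mul, Finset.sum_mul, map_sum] at this
  simp only [mul_assoc, PowerSeries.coeff_C_mul, PowerSeries.coeff_X_pow_mul', PowerSeries.coeff_mk,
    PowerSeries.coeff_C] at this
  simpa [hz, cc, cD] using this

lemma pS_succ (E : EllData (Fintype.card k) θ ell)
    (htr : Function.Injective (aeval θ : k[X] → L)) (d n : ℕ) (hn : n ≠ 0) :
    pS k θ (n + 1) d = ∑ i ∈ Finset.range (d + 1),
      if Fintype.card k ^ i ≤ n then cc k θ ell i d * pS k θ (n + 1 - Fintype.card k ^ i) d else 0 := by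
  have := congrArg (PowerSeries.coeff n) (pS_ps E htr d)
  rw [sub_mul, map_sub, one_mul, Finset.sum_mul, map_sum] at this
  simp only [mul_assoc, PowerSeries.coeff_C_mul, PowerSeries.coeff_X_pow_mul', PowerSeries.coeff_mk,
    PowerSeries.coeff_C, hn, if_false] at this
  rw [sub_eq_zero.1 this]
  refine Finset.sum_congr rfl fun i _ => ?_
  split_ifs with h
  · rw [show n - Fintype.card k ^ i + 1 = n + 1 - Fintype.card k ^ i by omega]
  · simp

lemma pS_small (E : EllData (Fintype.card k) θ ell)
    (htr : Function.Injective (aeval θ : k[X] → L)) (d n : ℕ) (hn : n + 1 ≤ Fintype.card k) :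
    pS k θ (n + 1) d = 1 / ell d ^ (n + 1) := by
  induction n with
  | zero => rw [zero_add, pS_one E htr, pow_one]
  | succ n ih =>
    rw [pS_succ E htr _ _ (by omega), Finset.sum_range_succ', Finset.sum_eq_zero]
    · have := ih (by omega)
      have h1 : cc k θ ell 0 d = 1 / ell d := by simp [cc, cD]
      simp only [pow_zero, h1, zero_add]
      rw [if_pos (by omega), show n + 1 + 1 - 1 = n + 1 by omega, this, div_mul_div_comm]
      rw [pow_succ' _ (n + 1), one_mul]
    · intro i _
      rw [if_neg]
      intro h
      have : Fintype.card k ^ 1 ≤ Fintype.card k ^ (i + 1) := Nat.pow_le_pow_right Fintype.card_pos (by omega)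
      rw [pow_one] at this
      omega

end carlitz

end part3

section part4

section shiftpart
variable {F L R : Type*} [Field F] [Field L] [Field R] [Algebra R L]
  {c : F →+* L} {ell : ℕ → L} {q : ℕ} {θ : L}

/-- shift -/
def pre (g : ℕ → L) : ℕ → L
  | 0 => 0
  | d + 1 => g d

lemma pre_add (f g : ℕ → L) : pre (f + g) = pre f + pre g := by
  funext d; cases d <;> simp [pre]

lemma pre_mul (f g : ℕ → L) : pre (f * g) = pre f * pre g := by
  funext d; cases d <;> simp [pre]

lemma pre_zero : pre (0 : ℕ → L) = 0 := by
  funext d; cases d <;> simp [pre]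

lemma pre_smul (r : R) (f : ℕ → L) : pre (r • f) = r • pre f := by
  funext d; cases d <;> simp [pre]

lemma pre_q_mem (E : EllData q θ ell) {ϑ : R} (hϑ : algebraMap R L ϑ = θ) :
    pre (gt c ell (1, q)) ∈ spG R c ell 1 q := by
  have hq := E.q2
  have : pre (gt c ell (1, q)) = (-(ϑ ^ q - ϑ)) • gGG (gt c ell) [(1, 1), (1, q - 1)] := by
    funext d
    cases d with
    | zero => simp [pre, gGG, gFF, gSg]
    | succ d =>
      rw [pre, E.rel 1 one_ne_zero, Pi.smul_apply, Algebra.smul_def]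
      simp [hϑ]
  rw [this]
  apply Submodule.smul_mem
  apply GG_mem
  refine ⟨?_, by simp; omega⟩
  intro x hx
  simp only [List.mem_cons, List.not_mem_nil, or_false] at hx
  rcases hx with rfl | rfl
  · exact ⟨by simp, by simp⟩
  · exact ⟨by simp; omega, by simp⟩

lemma pre_qm_mem (E : EllData q θ ell) {ϑ : R} (hϑ : algebraMap R L ϑ = θ) (m : ℕ) :
    pre (gt c ell (1, q * (m + 1))) ∈ spG R c ell 1 (q * (m + 1)) := by
  induction m with
  | zero => simpa using pre_q_mem E hϑ
  | succ m ih =>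
    have : gt c ell (1, q * (m + 1 + 1)) = gt c ell (1, q * (m + 1)) * gt c ell (1, q) := by
      rw [gt_mul]; simp [mul_add]
    rw [this, pre_mul, mul_add q (m + 1) 1, mul_one]
    exact spG_mul ih (pre_q_mem E hϑ)

/-- scaled word -/
def scw (q : ℕ) (u : List (F × ℕ)) : List (F × ℕ) := u.map fun x => (x.1, q * x.2)

lemma IsW.scw {w : ℕ} {u : List (F × ℕ)} (hq : 0 < q) (hu : IsW 1 w u) :
    IsW 1 (q * w) (scw q u) := by
  refine ⟨?_, ?_⟩
  · intro x hx
    obtain ⟨y, hy, rfl⟩ := List.mem_map.1 hx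
    exact ⟨Nat.mul_pos hq (hu.1 y hy).1, (hu.1 y hy).2⟩
  · rw [← hu.2, ZHPC.scw, List.map_map, ← List.sum_map_mul_left]
    simp [Function.comp_def]

lemma pre_scw_mem (E : EllData q θ ell) {ϑ : R} (hϑ : algebraMap R L ϑ = θ)
    (u : List (F × ℕ)) : ∀ w, IsW 1 w u →
    pre (gGG (gt c ell) (scw q u)) ∈ spG R c ell 1 (q * w) := by
  have hq := E.q2
  induction u with
  | nil =>
    intro w _
    rw [show gGG (gt c ell) (scw q []) = 0 from rfl, pre_zero]; exact zero_mem _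
  | cons x u ih =>
    intro w hw
    obtain ⟨hx, w', rfl, hu⟩ := hw.of_cons
    obtain ⟨e, s⟩ := x
    obtain rfl : e = 1 := by simpa using hx.2
    obtain ⟨m, rfl⟩ : ∃ m, s = m + 1 := ⟨s - 1, by have := hx.1; simp at this; omega⟩
    have key : pre (gGG (gt c ell) (scw q ((1, m + 1) :: u))) =
        pre (gt c ell (1, q * (m + 1))) * gFF (gt c ell) (scw q u)
         - pre (gt c ell (1, q * (m + 1))) * pre (gGG (gt c ell) (scw q u)) := by
      funext d
      cases d with
      | zero => simp [pre]
      | succ d =>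
        change gt c ell (1, q * (m + 1)) d * gFF (gt c ell) (scw q u) d =
          gt c ell (1, q * (m + 1)) d * gFF (gt c ell) (scw q u) (d + 1)
          - gt c ell (1, q * (m + 1)) d * gGG (gt c ell) (scw q u) d
        rw [gFF_succ]; ring
    rw [key, mul_add]
    exact sub_mem (spG_mul_spF (pre_qm_mem E hϑ m) (FF_mem (hu.scw (by omega))))
      (spG_mul (pre_qm_mem E hϑ m) (ih _ hu))

lemma EllData.frob_add (E : EllData q θ ell) (x y : L) : (x + y) ^ q = x ^ q + y ^ q := by
  have := E.frob (x + y) y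
  rw [add_sub_cancel_right] at this
  rw [this]; ring

lemma EllData.frob_sum (E : EllData q θ ell) {ι : Type*} (s : Finset ι) (f : ι → L) :
    (∑ i ∈ s, f i) ^ q = ∑ i ∈ s, f i ^ q := by
  have hq := E.q2
  induction s using Finset.induction_on with
  | empty => simp; omega
  | insert a s ha ih => rw [Finset.sum_insert ha, Finset.sum_insert ha, E.frob_add, ih]

lemma gt_pow (e : F) (he : e = 1) (s : ℕ) : gt c ell (e, s) ^ q = gt c ell (e, q * s) := by
  subst he
  funext d
  simp only [gt, Pi.pow_apply, one_pow, map_one, div_pow]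
  rw [← pow_mul, mul_comm s]

lemma FF_pow (E : EllData q θ ell) (u : List (F × ℕ)) (hu : ∀ x ∈ u, x.1 = 1) :
    gFF (gt c ell) u ^ q = gFF (gt c ell) (scw q u) := by
  induction u with
  | nil => simp [gFF, scw]
  | cons x u ih =>
    simp only [scw, List.map_cons, gFF]
    rw [show List.map (fun x : F × ℕ => (x.1, q * x.2)) u = scw q u from rfl,
      ← ih (fun y hy => hu y (by simp [hy])), ← gt_pow x.1 (hu x (by simp)), ← mul_pow]
    funext d
    simp only [gSg, Pi.pow_apply]
    rw [E.frob_sum]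

lemma GG_pow (E : EllData q θ ell) (u : List (F × ℕ)) (hu : ∀ x ∈ u, x.1 = 1) :
    gGG (gt c ell) u ^ q = gGG (gt c ell) (scw q u) := by
  have hq := E.q2
  cases u with
  | nil => simp [gGG, scw]; omega
  | cons x u =>
    simp only [scw, List.map_cons, gGG]
    rw [show List.map (fun x : F × ℕ => (x.1, q * x.2)) u = scw q u from rfl,
      ← FF_pow E u (fun y hy => hu y (by simp [hy])), ← gt_pow x.1 (hu x (by simp)), ← mul_pow]

lemma pre_pow_mem (E : EllData q θ ell) {ϑ : R} (hϑ : algebraMap R L ϑ = θ) {w : ℕ}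
    {f : ℕ → L} (hf : f ∈ spG R c ell 1 w) : pre (f ^ q) ∈ spG R c ell 1 (q * w) := by
  have hq := E.q2
  induction hf using Submodule.span_induction with
  | mem f hf =>
    obtain ⟨u, hu, rfl⟩ := hf
    rw [GG_pow E u (fun x hx => by simpa using (hu.1 x hx).2)]
    exact pre_scw_mem E hϑ u w hu
  | zero => rw [zero_pow (by omega), pre_zero]; exact zero_mem _
  | add a b _ _ ha hb =>
    have : (a + b) ^ q = a ^ q + b ^ q := by funext d; simp [E.frob_add]
    rw [this, pre_add]; exact add_mem ha hb
  | smul r a _ ha => rw [smul_pow, pre_smul]; exact Submodule.smul_mem _ _ ha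

/-- twisted inverse ell -/
def hh (q : ℕ) (ell : ℕ → L) : ℕ → ℕ → L
  | 0 => fun d => 1 / ell d
  | i + 1 => pre (hh q ell i ^ q)

lemma hh_eq (i d : ℕ) (hq : q ≠ 0) : hh q ell i d = if i ≤ d then 1 / ell (d - i) ^ q ^ i else 0 := by
  induction i generalizing d with
  | zero => simp [hh]
  | succ i ih =>
    cases d with
    | zero => simp [hh, pre]
    | succ d =>
      simp only [hh, pre, Pi.pow_apply, ih, Nat.add_le_add_iff_right]
      split_ifs
      · rw [show d + 1 - (i + 1) = d - i by omega, div_pow, one_pow, ← pow_mul, ← pow_succ]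
      · simp [hq]

lemma hh_mem (E : EllData q θ ell) {ϑ : R} (hϑ : algebraMap R L ϑ = θ) (i : ℕ) :
    hh q ell i ∈ spG R c ell 1 (q ^ i) := by
  induction i with
  | zero =>
    have : hh q ell 0 = gGG (gt c ell) [(1, 1)] := by
      funext d; simp [hh, gGG, gFF, gt]
    rw [this]
    apply GG_mem
    exact ⟨by simp [okL], by simp⟩
  | succ i ih =>
    rw [pow_succ']
    exact pre_pow_mem E hϑ ih

variable {k : Type*} [Field k] [Fintype k] [Algebra k L]

lemma cD_mem {ϑ : R} (hϑ : algebraMap R L ϑ = θ) (i : ℕ) :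
    ∃ r : R, algebraMap R L r = cD k θ i := by
  induction i with
  | zero => exact ⟨1, by simp [cD]⟩
  | succ i ih =>
    obtain ⟨r, hr⟩ := ih
    exact ⟨(ϑ ^ Fintype.card k ^ (i + 1) - ϑ) * r ^ Fintype.card k, by simp [cD, hr, hϑ]⟩

lemma cc_mem (E : EllData (Fintype.card k) θ ell) {ϑ : R} (hϑ : algebraMap R L ϑ = θ) (i : ℕ) :
    cc k θ ell i ∈ spG R c ell 1 (Fintype.card k ^ i) := by
  obtain ⟨r, hr⟩ := cD_mem (k := k) hϑ i
  have : cc k θ ell i = r⁻¹ • hh (Fintype.card k) ell i := by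
    funext d
    rw [Pi.smul_apply, Algebra.smul_def, map_inv₀, hr, hh_eq _ _ Fintype.card_ne_zero, cc]
    split_ifs
    · rw [one_div, one_div, mul_inv]
    · simp
  rw [this]
  exact Submodule.smul_mem _ _ (hh_mem E hϑ i)

open Polynomial in
lemma pS_mem (E : EllData (Fintype.card k) θ ell)
    (htr : Function.Injective (aeval θ : k[X] → L)) {ϑ : R} (hϑ : algebraMap R L ϑ = θ) (n : ℕ) :
    pS k θ (n + 1) ∈ spG R c ell 1 (n + 1) := by
  have hq := E.q2
  induction n using Nat.strong_induction_on with
  | _ n ih =>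
    by_cases hn : n = 0
    · subst hn
      have : pS k θ (0 + 1) = hh (Fintype.card k) ell 0 := by
        funext d; simp [hh, pS_one E htr]
      rw [this]
      simpa using hh_mem E hϑ 0
    have : pS k θ (n + 1) = ∑ i ∈ (Finset.range n).filter (fun i => Fintype.card k ^ i ≤ n),
        cc k θ ell i * pS k θ (n + 1 - Fintype.card k ^ i) := by
      funext d
      rw [pS_succ E htr d n hn, Finset.sum_apply, Finset.sum_filter]
      have e1 : ∀ m, d + 1 ≤ m → (∑ i ∈ Finset.range (d + 1),
          if Fintype.card k ^ i ≤ n then cc k θ ell i d * pS k θ (n + 1 - Fintype.card k ^ i) d else 0)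
          = ∑ i ∈ Finset.range m,
          if Fintype.card k ^ i ≤ n then cc k θ ell i d * pS k θ (n + 1 - Fintype.card k ^ i) d else 0 := by
        intro m hm
        apply Finset.sum_subset (Finset.range_mono hm)
        intro i _ hi
        have : ¬ i ≤ d := by simpa using hi
        simp [cc, this]
      have e2 : ∀ m, n ≤ m → (∑ i ∈ Finset.range n,
          if Fintype.card k ^ i ≤ n then cc k θ ell i d * pS k θ (n + 1 - Fintype.card k ^ i) d else 0)
          = ∑ i ∈ Finset.range m,
          if Fintype.card k ^ i ≤ n then cc k θ ell i d * pS k θ (n + 1 - Fintype.card k ^ i) d else 0 := by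
        intro m hm
        apply Finset.sum_subset (Finset.range_mono hm)
        intro i _ hi
        have h1 : n ≤ i := by simpa using hi
        have h2 : i < Fintype.card k ^ i := Nat.lt_pow_self (by omega)
        rw [if_neg (by omega)]
      rw [e1 (n + (d + 1)) (by omega)]
      simp only [Pi.mul_apply]
      rw [e2 (n + (d + 1)) (by omega)]
    rw [this]
    apply Submodule.sum_mem
    intro i hi
    have hi2 := (Finset.mem_filter.1 hi).2
    have hpos : 0 < Fintype.card k ^ i := pow_pos Fintype.card_pos _
    have h3 := ih (n - Fintype.card k ^ i) (by omega)
    rw [show n - Fintype.card k ^ i + 1 = n + 1 - Fintype.card k ^ i by omega] at h3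
    have h4 := spG_mul (cc_mem E hϑ i) h3
    rwa [show Fintype.card k ^ i + (n + 1 - Fintype.card k ^ i) = n + 1 by omega] at h4

variable (k) in
/-- zeta letter -/
def zt (c : F →+* L) (θ : L) (x : F × ℕ) (d : ℕ) : L := c (x.1 ^ d) * pS k θ x.2 d

open Polynomial in
lemma zt_mem (E : EllData (Fintype.card k) θ ell)
    (htr : Function.Injective (aeval θ : k[X] → L)) {ϑ : R} (hϑ : algebraMap R L ϑ = θ)
    {N : ℕ} (x : F × ℕ) (hx : okL N x) : zt k c θ x ∈ spG R c ell N x.2 := by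
  obtain ⟨e, s⟩ := x
  obtain ⟨m, rfl⟩ : ∃ m, s = m + 1 := ⟨s - 1, by have := hx.1; simp at this; omega⟩
  have : zt k c θ (e, m + 1) = gt c ell (e, 0) * pS k θ (m + 1) := by
    funext d; simp [zt, gt]
  rw [this]
  exact chi_mul_mem hx.2 (spG_mono_one (pS_mem E htr hϑ m))

open Polynomial in
lemma zt_small (E : EllData (Fintype.card k) θ ell)
    (htr : Function.Injective (aeval θ : k[X] → L)) (x : F × ℕ) (h0 : 0 < x.2)
    (hx : x.2 ≤ Fintype.card k) : zt k c θ x = gt c ell x := by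
  obtain ⟨e, s⟩ := x
  obtain ⟨m, rfl⟩ : ∃ m, s = m + 1 := ⟨s - 1, by simp at h0; omega⟩
  funext d
  simp only [zt, gt]
  rw [pS_small E htr d m hx, mul_one_div]

end shiftpart

end part4

section part5

section valpart
open Filter Topology
variable {L Γ₀ : Type*} [Field L] [LinearOrderedCommGroupWithZero Γ₀] [vv : Valued L Γ₀]

lemma tz {ι : Type*} {l : Filter ι} {f : ι → L}
    (h : ∀ γ : Γ₀ˣ, ∀ᶠ i in l, Valued.v (f i) < (γ : Γ₀)) : Tendsto f l (𝓝 0) := by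
  rw [(Valued.hasBasis_nhds_zero L Γ₀).tendsto_right_iff]
  intro γ _
  have h0 : MonoidWithZeroHom.ValueGroup₀.embedding (γ : MonoidWithZeroHom.ValueGroup₀ (.ofClass vv.v)) ≠ (0 : Γ₀) := by
    simp
  filter_upwards [h (Units.mk0 _ h0)] with i hi
  change Valued.v.restrict (f i) < _
  rw [Valuation.restrict_lt_iff_lt_embedding]
  exact hi

lemma valued_nonarch : NonarchimedeanAddGroup L where
  is_nonarchimedean := by
    intro U hU
    obtain ⟨γ, hγ⟩ := Valued.mem_nhds_zero.1 hU
    exact ⟨⟨Valuation.ltAddSubgroup (Valued.v.restrict) γ, Valued.isOpen_ball (R := L) _⟩, hγ⟩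

lemma tz_summable [CompleteSpace L] {ι : Type*} {f : ι → L}
    (h : Tendsto f cofinite (𝓝 0)) : Summable f := by
  have := valued_nonarch (L := L) (Γ₀ := Γ₀)
  exact NonarchimedeanAddGroup.summable_of_tendsto_cofinite_zero h

/-- small sequences -/
def Sml (τ : ℕ → L) : Prop :=
  (∀ d, vv.v (τ d) ≤ 1) ∧ ∀ γ : Γ₀ˣ, ∃ M, ∀ d, M ≤ d → vv.v (τ d) < (γ : Γ₀)

lemma FF_le {X : Type*} (τ : X → ℕ → L) (u : List X) (h : ∀ x ∈ u, Sml (τ x)) (d : ℕ) :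
    vv.v (gFF τ u d) ≤ 1 := by
  induction u generalizing d with
  | nil => simp [gFF]
  | cons x u ih =>
    simp only [gFF, gSg, Pi.mul_apply]
    apply Valuation.map_sum_le
    intro i _
    rw [map_mul]
    exact mul_le_one' ((h x (by simp)).1 i) (ih (fun y hy => h y (by simp [hy])) i)

lemma GG_tendsto {X : Type*} (τ : X → ℕ → L) (u : List X) (h : ∀ x ∈ u, Sml (τ x)) :
    Tendsto (gGG τ u) atTop (𝓝 0) := by
  cases u with
  | nil => exact tendsto_const_nhds
  | cons x u =>
    apply tz
    intro γ
    obtain ⟨M, hM⟩ := (h x (by simp)).2 γ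
    filter_upwards [eventually_ge_atTop M] with d hd
    simp only [gGG, Pi.mul_apply, map_mul]
    refine lt_of_le_of_lt ?_ (hM d hd)
    exact mul_le_of_le_one_right' (FF_le τ u (fun y hy => h y (by simp [hy])) d)

/-- decreasing tuples below d -/
def St (n d : ℕ) : Finset (Fin n → ℕ) :=
  (Fintype.piFinset fun _ => Finset.range d).filter StrictAnti

lemma mem_St {n d : ℕ} {f : Fin n → ℕ} : f ∈ St n d ↔ StrictAnti f ∧ ∀ i, f i < d := by
  simp [St, Fintype.mem_piFinset, and_comm]

lemma anti_cons {n j : ℕ} {f : Fin n → ℕ} :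
    StrictAnti (Fin.cons j f : Fin (n + 1) → ℕ) ↔ f ∈ St n j := by
  rw [mem_St]
  constructor
  · intro h
    refine ⟨fun a b hab => ?_, fun i => ?_⟩
    · have := h (Fin.succ_lt_succ_iff.2 hab)
      simpa using this
    · have := h (Fin.succ_pos i)
      simpa using this
  · rintro ⟨h1, h2⟩ a b hab
    induction b using Fin.cases with
    | zero => exact absurd hab (Fin.not_lt_zero _)
    | succ b =>
      induction a using Fin.cases with
      | zero => simpa using h2 b
      | succ a => simpa using h1 (Fin.succ_lt_succ_iff.1 hab)

lemma St_succ_sum {M : Type*} [AddCommMonoid M] (n d : ℕ) (g : (Fin (n + 1) → ℕ) → M) :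
    ∑ f ∈ St (n + 1) d, g f = ∑ j ∈ Finset.range d, ∑ f ∈ St n j, g (Fin.cons j f) := by
  rw [Finset.sum_sigma']
  refine Finset.sum_bij' (fun f _ => ⟨f 0, Fin.tail f⟩) (fun p _ => Fin.cons p.1 p.2) ?_ ?_ ?_ ?_ ?_
  · intro f hf
    have h := mem_St.1 hf
    rw [Finset.mem_sigma]
    refine ⟨by simpa using h.2 0, ?_⟩
    rw [← anti_cons]
    simpa using h.1
  · rintro ⟨j, f⟩ h
    rw [Finset.mem_sigma] at h
    have h1 : j < d := by simpa using h.1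
    rw [mem_St]
    refine ⟨anti_cons.2 h.2, fun i => ?_⟩
    induction i using Fin.cases with
    | zero => simpa using h1
    | succ i =>
      have := (mem_St.1 h.2).2 i
      simp only [Fin.cons_succ]
      simp only at this
      omega
  · intro f _; simp
  · rintro ⟨j, f⟩ _; simp
  · intro f _; simp

lemma FF_eq_St {X : Type*} (τ : X → ℕ → L) (n : ℕ) (x : Fin n → X) (d : ℕ) :
    gFF τ (List.ofFn x) d = ∑ f ∈ St n d, ∏ i, τ (x i) (f i) := by
  induction n generalizing d with
  | zero =>
    have : St 0 d = {Fin.elim0} := by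
      ext f
      rw [mem_St]
      simp only [Finset.mem_singleton]
      constructor
      · intro _; exact Subsingleton.elim _ _
      · intro _; exact ⟨fun a => a.elim0, fun a => a.elim0⟩
    simp [gFF, this]
  | succ n ih =>
    rw [List.ofFn_succ, St_succ_sum]
    simp only [gFF, gSg, Pi.mul_apply]
    refine Finset.sum_congr rfl fun j _ => ?_
    rw [ih, Finset.mul_sum]
    refine Finset.sum_congr rfl fun f _ => ?_
    rw [Fin.prod_univ_succ]; simp

lemma GG_eq_St {X : Type*} (τ : X → ℕ → L) (n : ℕ) (x : Fin (n + 1) → X) (d : ℕ) :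
    gGG τ (List.ofFn x) d = ∑ f ∈ St n d, ∏ i, τ (x i) ((Fin.cons d f : Fin (n + 1) → ℕ) i) := by
  rw [List.ofFn_succ]
  simp only [gGG, Pi.mul_apply]
  rw [FF_eq_St, Finset.mul_sum]
  refine Finset.sum_congr rfl fun f _ => ?_
  rw [Fin.prod_univ_succ]; simp

lemma anti_hasSum [CompleteSpace L] {X : Type*} (τ : X → ℕ → L) (n : ℕ) (x : Fin n → X)
    (h : ∀ i, Sml (τ (x i))) :
    Tendsto (gFF τ (List.ofFn x)) atTop
      (𝓝 (∑' f : {f : Fin n → ℕ // StrictAnti f}, ∏ i, τ (x i) (f.1 i))) := by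
  have hs : Summable (fun f : {f : Fin n → ℕ // StrictAnti f} => ∏ i, τ (x i) (f.1 i)) := by
    apply tz_summable (Γ₀ := Γ₀)
    apply tz
    intro γ
    choose M hM using fun i => (h i).2 γ
    have hfin : Set.Finite {f : {f : Fin n → ℕ // StrictAnti f} | ∀ i, f.1 i < M i} := by
      have h1 : Set.Finite {f : Fin n → ℕ | ∀ i, f i < M i} := by
        refine (Fintype.piFinset fun i => Finset.range (M i)).finite_toSet.subset ?_
        intro f hf
        simpa [Fintype.mem_piFinset] using hf
      exact h1.preimage Subtype.val_injective.injOn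
    refine hfin.subset ?_
    intro f hf i
    by_contra hi
    apply hf
    change vv.v (∏ i, τ (x i) (f.1 i)) < γ
    rw [map_prod, ← Finset.mul_prod_erase _ _ (Finset.mem_univ i)]
    refine lt_of_le_of_lt ?_ (hM i (f.1 i) (not_lt.1 hi))
    apply mul_le_of_le_one_right'
    exact Finset.prod_le_one' fun j _ => (h j).1 _
  have h2 := hs.hasSum
  have h3 : Tendsto (fun d => (St n d).subtype StrictAnti) atTop atTop := by
    apply tendsto_atTop_finset_of_monotone
    · intro a b hab f hf
      rw [Finset.mem_subtype, mem_St] at hf ⊢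
      exact ⟨hf.1, fun i => lt_of_lt_of_le (hf.2 i) hab⟩
    · intro f
      refine ⟨(∑ i, f.1 i) + 1, ?_⟩
      rw [Finset.mem_subtype, mem_St]
      refine ⟨f.2, fun i => Nat.lt_succ_of_le ?_⟩
      exact Finset.single_le_sum (f := f.1) (fun _ _ => Nat.zero_le _) (Finset.mem_univ i)
  refine (h2.comp h3).congr fun d => ?_
  rw [FF_eq_St]
  simp only [Function.comp]
  exact Finset.sum_subtype_of_mem (fun f : Fin n → ℕ => ∏ i, τ (x i) (f i))
    (fun f hf => (mem_St.1 hf).1)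

lemma sd_eq {M : Type*} [AddCommMonoid M] [TopologicalSpace M] [T2Space M] (n d : ℕ)
    (g : (Fin (n + 1) → ℕ) → M) :
    ∑' e : {f : Fin (n + 1) → ℕ // StrictAnti f ∧ ∀ i : Fin (n + 1), i.val = 0 → (f i : ℤ) = (d : ℤ)},
      g e.1 = ∑ f ∈ St n d, g (Fin.cons d f) := by
  have e1 := tsum_subtype {f : Fin (n + 1) → ℕ | StrictAnti f ∧ ∀ i : Fin (n + 1), i.val = 0 → (f i : ℤ) = (d : ℤ)} g
  refine e1.trans ?_
  have hmem : ∀ f : Fin (n + 1) → ℕ, (StrictAnti f ∧ ∀ i : Fin (n + 1), i.val = 0 → (f i : ℤ) = (d : ℤ)) ↔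
      f ∈ (St n d).image (fun f => (Fin.cons d f : Fin (n + 1) → ℕ)) := by
    intro f
    rw [Finset.mem_image]
    constructor
    · rintro ⟨h1, h2⟩
      have h0 : f 0 = d := by exact_mod_cast h2 0 rfl
      refine ⟨Fin.tail f, ?_, ?_⟩
      · rw [← anti_cons, ← h0]; simpa using h1
      · rw [← h0]; simp
    · rintro ⟨a, ha, rfl⟩
      refine ⟨anti_cons.2 ha, fun i hi => ?_⟩
      obtain rfl : i = 0 := Fin.ext hi
      simp
  rw [tsum_eq_sum (s := (St n d).image (fun f => (Fin.cons d f : Fin (n + 1) → ℕ))),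
    Finset.sum_image]
  · refine Finset.sum_congr rfl fun f hf => ?_
    rw [Set.indicator_of_mem]
    exact (hmem _).2 (Finset.mem_image_of_mem _ hf)
  · intro a _ b _ hab
    exact Fin.cons_right_injective _ hab
  · intro f hf
    rw [Set.indicator_of_notMem]
    intro h
    exact hf ((hmem f).1 h)

end valpart

end part5

section part6

section conc
open Filter Topology Polynomial
variable (Fq : Type) [Field Fq] [Fintype Fq]

lemma theta_pow (n : ℕ) : theta Fq ^ n = HahnSeries.single (-(n : ℤ)) 1 := by
  rw [theta, HahnSeries.single_pow]; simp

lemma coeff_eval (P : (Fb Fq)[X]) (n : ℕ) :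
    (P.eval₂ (cst Fq) (theta Fq)).coeff (-(n : ℤ)) = P.coeff n := by
  induction P using Polynomial.induction_on' with
  | add p q hp hq => simp [hp, hq]
  | monomial m a =>
    rw [eval₂_monomial, theta_pow, cst, HahnSeries.C_apply, HahnSeries.single_mul_single,
      HahnSeries.coeff_single, coeff_monomial]
    simp [eq_comm]

lemma eval_inj : Function.Injective (eval₂RingHom (cst Fq) (theta Fq)) := by
  rw [injective_iff_map_eq_zero]
  intro P hP
  ext n
  rw [← coeff_eval Fq P n]
  rw [coe_eval₂RingHom] at hP
  rw [hP]; simp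

/-- algebra structure -/
@[reducible] def algK : Algebra Fq (Kinf Fq) :=
  ((cst Fq).comp (algebraMap Fq (Fb Fq))).toAlgebra

attribute [local instance] algK

lemma algK_apply (a : Fq) : algebraMap Fq (Kinf Fq) a = cst Fq (algebraMap Fq (Fb Fq) a) := rfl

lemma monicVal_eq (e : ℕ) (a : Fin e → Fq) : monicVal Fq e a = mv (theta Fq) e a := rfl

lemma htrK : Function.Injective (aeval (theta Fq) : Fq[X] → Kinf Fq) := by
  have : ∀ P : Fq[X], aeval (theta Fq) P =
      eval₂RingHom (cst Fq) (theta Fq) (P.map (algebraMap Fq (Fb Fq))) := by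
    intro P
    rw [coe_eval₂RingHom, eval₂_map, aeval_def]
    rfl
  intro P Q h
  rw [this, this] at h
  exact map_injective _ (algebraMap Fq (Fb Fq)).injective (eval_inj Fq h)

lemma v_theta : Valued.v (theta Fq) = WithZero.exp (1 : ℤ) := by
  rw [theta, LaurentSeries.valuation_single_zpow]; simp

lemma v_theta_gt : 1 < Valued.v (theta Fq) := by
  rw [v_theta, ← WithZero.exp_zero, WithZero.exp_lt_exp]; norm_num

lemma q2' : 2 ≤ qc Fq := Fintype.one_lt_card (α := Fq)

lemma v_ell_succ (i : ℕ) (hi : i ≠ 0) :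
    Valued.v (theta Fq) ≤ Valued.v (theta Fq - theta Fq ^ qc Fq ^ i) := by
  have h1 := v_theta_gt Fq
  have h2 : 1 < qc Fq ^ i := Nat.one_lt_pow hi (q2' Fq)
  have h3 : Valued.v (theta Fq) < Valued.v (theta Fq ^ qc Fq ^ i) := by
    rw [map_pow]
    conv_lhs => rw [← pow_one (Valued.v (theta Fq))]
    exact pow_lt_pow_right₀ h1 h2
  rw [Valuation.map_sub_eq_of_lt_right _ h3]
  exact h3.le

lemma ell_succ' (d : ℕ) : ell Fq (d + 1) = ell Fq d * (theta Fq - theta Fq ^ qc Fq ^ (d + 1)) := by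
  rw [ell, Finset.prod_Icc_succ_top (by omega), ell]

lemma v_ell (d : ℕ) : Valued.v (theta Fq) ^ d ≤ Valued.v (ell Fq d) := by
  induction d with
  | zero => simp [ell]
  | succ d ih =>
    rw [ell_succ', map_mul, pow_succ]
    exact mul_le_mul' ih (v_ell_succ Fq _ (by omega))

lemma ellData : EllData (Fintype.card Fq) (theta Fq) (ell Fq) where
  zero := by simp [ell]
  succ := ell_succ' Fq
  ne := by
    intro d h
    have h1 := v_ell Fq d
    rw [h, map_zero] at h1
    have h2 : 0 < Valued.v (theta Fq) ^ d := pow_pos (lt_trans zero_lt_one (v_theta_gt Fq)) d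
    exact absurd h1 (not_le.2 h2)
  frob := fun x y => frob_sub' (k := Fq) x y
  q2 := q2' Fq

lemma v_cst (x : Fb Fq) : Valued.v (cst Fq x) ≤ 1 := by
  have := (LaurentSeries.valuation_le_iff_coeff_lt_eq_zero (Fb Fq) (D := 0) (f := cst Fq x)).2
    (fun n hn => by
      rw [cst, HahnSeries.C_apply, HahnSeries.coeff_single, if_neg (by omega)])
  simpa using this

lemma sml_aux {Γ : Type*} [LinearOrderedCommGroupWithZero Γ] {t a b : Γ} {d s : ℕ} (ht : 1 < t)
    (ha : a ≤ 1) (hb : t ^ d ≤ b) (hs : 0 < s) : a / b ^ s ≤ t⁻¹ ^ d := by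
  have h3 : 1 ≤ t ^ d := one_le_pow₀ ht.le
  have h4 : t ^ d ≤ b ^ s := hb.trans (le_self_pow₀ (h3.trans hb) (by omega))
  have h0 : 0 < t ^ d := lt_of_lt_of_le zero_lt_one h3
  rw [inv_pow, div_eq_mul_inv]
  exact le_trans (mul_le_of_le_one_left' ha) (inv_anti₀ h0 h4)

lemma sml_of {L Γ : Type*} [Field L] [LinearOrderedCommGroupWithZero Γ] [MulArchimedean Γ]
    [vv : Valued L Γ] {τ : ℕ → L} {t : Γ} (ht : 1 < t) (key : ∀ d, vv.v (τ d) ≤ t⁻¹ ^ d) :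
    Sml τ := by
  have hlt : t⁻¹ < 1 := inv_lt_one_of_one_lt₀ ht
  refine ⟨fun d => (key d).trans (pow_le_one' hlt.le d), fun γ => ?_⟩
  obtain ⟨M, hM⟩ := exists_pow_lt₀ hlt γ
  refine ⟨M, fun d hd => ((key d).trans ?_).trans_lt hM⟩
  exact pow_le_pow_right_of_le_one' hlt.le hd

lemma sml_gen {F L Γ : Type*} [Field F] [Field L] [LinearOrderedCommGroupWithZero Γ]
    [MulArchimedean Γ] [vv : Valued L Γ] {c : F →+* L} {el : ℕ → L} {θ : L}
    (ht : 1 < vv.v θ) (hc : ∀ x, vv.v (c x) ≤ 1) (he : ∀ d, vv.v θ ^ d ≤ vv.v (el d))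
    (x : F × ℕ) (hx : 0 < x.2) : Sml (gt c el x) := by
  refine sml_of ht fun d => ?_
  rw [gt, map_div₀, map_pow vv.v]
  exact sml_aux ht (hc _) (he d) hx

lemma sml_gt (x : Fb Fq × ℕ) (hx : 0 < x.2) : Sml (gt (cst Fq) (ell Fq) x) :=
  sml_gen (v_theta_gt Fq) (v_cst Fq) (v_ell Fq) x hx

/-- array of a word -/
def toA (u : List (Fb Fq × ℕ)) : PArr (Fb Fq) :=
  ⟨u.length, fun i => (u.get i).2, fun i => (u.get i).1⟩

/-- Li of a word -/
def LLw (u : List (Fb Fq × ℕ)) : Kinf Fq := Li Fq (toA Fq u)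

/-- word of an array -/
def toW (A : PArr (Fb Fq)) : List (Fb Fq × ℕ) := List.ofFn fun i => (A.eps i, A.s i)

lemma toW_toA (u : List (Fb Fq × ℕ)) : toW Fq (toA Fq u) = u := by
  simp [toW, toA]

lemma Li_tendsto (A : PArr (Fb Fq)) (h : ∀ i, 0 < A.s i) :
    Tendsto (gFF (gt (cst Fq) (ell Fq)) (toW Fq A)) atTop (𝓝 (Li Fq A)) :=
  anti_hasSum (gt (cst Fq) (ell Fq)) A.depth (fun i => (A.eps i, A.s i))
    (fun i => sml_gt Fq _ (h i))

lemma LLw_toW (A : PArr (Fb Fq)) (h : ∀ i, 0 < A.s i) : LLw Fq (toW Fq A) = Li Fq A := by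
  have h1 := Li_tendsto Fq A h
  have h2 := Li_tendsto Fq (toA Fq (toW Fq A)) (by
    intro i
    have : (toW Fq A).get i ∈ toW Fq A := List.get_mem _ _
    obtain ⟨j, hj⟩ := List.mem_ofFn.1 this
    change 0 < ((toW Fq A).get i).2
    rw [← hj]; exact h j)
  rw [toW_toA] at h2
  exact tendsto_nhds_unique h2 h1

lemma limData (N : ℕ) : LimData (cst Fq) (ell Fq) N (LLw Fq) where
  hF := by
    intro u hu
    have := Li_tendsto Fq (toA Fq u) (fun i => (hu _ (List.get_mem u i)).1)
    rwa [toW_toA] at this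
  hG := fun u hu => GG_tendsto _ u fun x hx => sml_gt Fq x (hu x hx).1

lemma Sd_eq (A : PArr (Fb Fq)) (hA : 0 < A.depth) (d : ℕ) :
    Sd Fq (d : ℤ) A = gGG (zt Fq (cst Fq) (theta Fq)) (toW Fq A) d := by
  obtain ⟨n, s, eps⟩ := A
  obtain ⟨n, rfl⟩ : ∃ m, n = m + 1 := ⟨n - 1, by simp at hA; omega⟩
  refine (sd_eq n d (fun e => ∑ c : (∀ i, Fin (e i) → Fq),
      ∏ i, cst Fq (eps i ^ e i) / monicVal Fq (e i) (c i) ^ s i)).trans ?_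
  rw [toW, GG_eq_St]
  refine Finset.sum_congr rfl fun f _ => ?_
  set e : Fin (n + 1) → ℕ := Fin.cons d f
  simp only [zt, pS, Finset.mul_sum, mul_one_div, ← monicVal_eq]
  rw [Finset.prod_univ_sum, Fintype.piFinset_univ]

end conc

end part6

section part7

section fin
open Filter Topology Polynomial
variable (Fq : Type) [Field Fq] [Fintype Fq]
set_option synthInstance.maxHeartbeats 1000000
attribute [local instance] algK

lemma AN_le (N : ℕ) : AN Fq N ≤ (KNf Fq N).toSubring := by
  rw [AN, Subring.closure_le]
  exact Subfield.subset_closure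

lemma AN_range (N : ℕ) : AN Fq N ≤ (eval₂RingHom (cst Fq) (theta Fq)).range := by
  rw [AN, Subring.closure_le]
  rintro x (⟨a, -, rfl⟩ | hx)
  · exact ⟨C a, by simp⟩
  · exact ⟨X, by simp [Set.mem_singleton_iff.1 hx]⟩

lemma theta_AN (N : ℕ) : theta Fq ∈ AN Fq N := Subring.subset_closure (Or.inr rfl)

lemma cst_AN (N : ℕ) (e : Fb Fq) (he : e ^ N = 1) : cst Fq e ∈ AN Fq N :=
  Subring.subset_closure (Or.inl ⟨e, Subfield.subset_closure (Or.inr he), rfl⟩)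

lemma unit_ne (y : Kinf Fq) (N : ℕ) (hy : y ∈ AN Fq N) :
    1 + (theta Fq ^ Fintype.card Fq - theta Fq) * y ≠ 0 := by
  obtain ⟨P, rfl⟩ := AN_range Fq N hy
  have h0 : Fintype.card Fq ≠ 0 := Fintype.card_ne_zero
  intro h
  have h1 : eval₂RingHom (cst Fq) (theta Fq) (1 + (X ^ Fintype.card Fq - X) * P) = 0 := by
    rw [map_add, map_mul, map_sub, map_pow, map_one, coe_eval₂RingHom, eval₂_X]
    exact h
  rw [map_eq_zero_iff _ (eval_inj Fq)] at h1
  have h2 := congrArg (eval 0) h1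
  simp [h0] at h2

lemma transfer {L : Type*} [Field L] (A : Subring L) (K : Subfield L) (hAK : A ≤ K.toSubring)
    (S T : Set L) (a : A) (ha : (a : L) ≠ 0)
    (h : ∀ x ∈ Submodule.span A S, a • x ∈ Submodule.span A T) :
    Submodule.span K S ≤ Submodule.span K T := by
  have h1 : ∀ x ∈ Submodule.span A T, x ∈ Submodule.span K T := by
    intro x hx
    induction hx using Submodule.span_induction with
    | mem x hx => exact Submodule.subset_span hx
    | zero => exact zero_mem _
    | add x y _ _ hx hy => exact add_mem hx hy
    | smul r x _ hx => exact Submodule.smul_mem _ (⟨r.1, hAK r.2⟩ : K) hx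
  rw [Submodule.span_le]
  intro x hx
  have h2 := h1 _ (h x (Submodule.subset_span hx))
  have h3 := Submodule.smul_mem _ ((⟨a.1, hAK a.2⟩ : K)⁻¹) h2
  have h4 : ((⟨a.1, hAK a.2⟩ : K)⁻¹) • (a • x) = x := by
    change (a : L)⁻¹ * ((a : L) * x) = x
    field_simp
  rw [h4] at h3
  exact h3

lemma spT_le (N w : ℕ) (hN : 0 < N) :
    spL (KNf Fq N) (LLw Fq) N w ≤ spLc (KNf Fq N) (LLw Fq) (· ≤ Fintype.card Fq) N w := by
  let δ : AN Fq N := ⟨theta Fq ^ Fintype.card Fq - theta Fq,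
    sub_mem (pow_mem (theta_AN Fq N) _) (theta_AN Fq N)⟩
  obtain ⟨y, hy⟩ := spanT (R := AN Fq N) (limData Fq N) (ellData Fq) hN (δ := δ) rfl
    (fun e he => ⟨⟨cst Fq e, cst_AN Fq N e he⟩, rfl⟩) w
  exact transfer (AN Fq N) (KNf Fq N) (AN_le Fq N) _ _ (1 + δ * y) (unit_ne Fq y.1 N y.2) hy

lemma spS_le (N w : ℕ) (hN : 0 < N) :
    spL (KNf Fq N) (LLw Fq) N w ≤ spLc (KNf Fq N) (LLw Fq) (fun s => ¬ Fintype.card Fq ∣ s) N w := by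
  let δ : AN Fq N := ⟨theta Fq ^ Fintype.card Fq - theta Fq,
    sub_mem (pow_mem (theta_AN Fq N) _) (theta_AN Fq N)⟩
  obtain ⟨y, hy⟩ := spanS (R := AN Fq N) (limData Fq N) (ellData Fq) hN (δ := δ) rfl
    (fun e he => ⟨⟨cst Fq e, cst_AN Fq N e he⟩, rfl⟩) w
  exact transfer (AN Fq N) (KNf Fq N) (AN_le Fq N) _ _ (1 + δ * y) (unit_ne Fq y.1 N y.2) hy

lemma isW_toW {N w : ℕ} {A : PArr (Fb Fq)} (h1 : A.Positive N) (h2 : A.wt = w) :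
    IsW N w (toW Fq A) := by
  refine ⟨?_, ?_⟩
  · intro x hx
    obtain ⟨i, rfl⟩ := List.mem_ofFn.1 hx
    exact ⟨h1.1 i, h1.2 i⟩
  · rw [← h2, toW, List.map_ofFn, List.sum_ofFn]; rfl

lemma pos_toA {N w : ℕ} {u : List (Fb Fq × ℕ)} (hu : IsW N w u) :
    (toA Fq u).Positive N ∧ (toA Fq u).wt = w := by
  refine ⟨⟨fun i => (hu.1 _ (List.get_mem u i)).1, fun i => (hu.1 _ (List.get_mem u i)).2⟩, ?_⟩
  have h : ((toW Fq (toA Fq u)).map Prod.snd).sum = (toA Fq u).wt := by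
    rw [toW, List.map_ofFn, List.sum_ofFn]; rfl
  rw [← h, toW_toA, hu.2]

lemma word_pos {N w : ℕ} (hw : 0 < w) {u : List (Fb Fq × ℕ)} (hu : IsW N w u) : u ≠ [] := by
  rintro rfl
  have := hu.2
  simp at this
  omega

lemma GG_hasSum {N : ℕ} {u : List (Fb Fq × ℕ)} (hu : ∀ x ∈ u, okL N x) (h0 : u ≠ []) :
    HasSum (gGG (gt (cst Fq) (ell Fq)) u) (LLw Fq u) := by
  have hs : Summable (gGG (gt (cst Fq) (ell Fq)) u) := by
    apply tz_summable
    rw [Nat.cofinite_eq_atTop]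
    exact (limData Fq N).hG u hu
  rw [hs.hasSum_iff_tendsto_nat]
  have := (limData Fq N).hF u hu
  rw [← gSg_GG _ _ h0] at this
  exact this

/-- summable with sum in P -/
def sumT {R L : Type*} [CommRing R] [Field L] [Algebra R L] [TopologicalSpace L]
    [IsTopologicalRing L] (P : Submodule R L) : Submodule R (ℕ → L) where
  carrier := {f | ∃ m ∈ P, HasSum f m}
  zero_mem' := ⟨0, zero_mem _, hasSum_zero⟩
  add_mem' := by
    rintro a b ⟨m, hm, h1⟩ ⟨m', hm', h2⟩
    exact ⟨m + m', add_mem hm hm', h1.add h2⟩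
  smul_mem' := by
    rintro r a ⟨m, hm, h1⟩
    refine ⟨r • m, Submodule.smul_mem _ _ hm, ?_⟩
    have := h1.mul_left (algebraMap R L r)
    simp only [← Algebra.smul_def] at this
    exact this

lemma spG_sum (N w : ℕ) (hw : 0 < w) :
    spG (KNf Fq N) (cst Fq) (ell Fq) N w ≤ sumT (spL (KNf Fq N) (LLw Fq) N w) := by
  apply Submodule.span_le.2
  rintro _ ⟨u, hu, rfl⟩
  exact ⟨LLw Fq u, Submodule.subset_span ⟨u, hu, rfl⟩, GG_hasSum Fq hu.1 (word_pos Fq hw hu)⟩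

lemma depth_pos {w : ℕ} (hw : 0 < w) {A : PArr (Fb Fq)} (h : A.wt = w) : 0 < A.depth := by
  obtain ⟨n, s, e⟩ := A
  rcases Nat.eq_zero_or_pos n with rfl | h0
  · simp [PArr.wt] at h; omega
  · exact h0

lemma theta_K (N : ℕ) : theta Fq ∈ KNf Fq N := Subfield.subset_closure (Or.inr rfl)

lemma CZ_le (N w : ℕ) (hw : 0 < w) : CZ Fq N w ≤ spL (KNf Fq N) (LLw Fq) N w := by
  apply Submodule.span_le.2
  rintro _ ⟨A, h1, h2, rfl⟩
  have hG := GG_other_mem (R := KNf Fq N) (c := cst Fq) (ell := ell Fq) (N := N)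
    (zt Fq (cst Fq) (theta Fq))
    (fun x hx => zt_mem (ellData Fq) (htrK Fq) (ϑ := (⟨theta Fq, theta_K Fq N⟩ : KNf Fq N)) rfl x hx)
    (toW Fq A) w (isW_toW Fq h1 h2)
  obtain ⟨m, hm, hs⟩ := spG_sum Fq N w hw hG
  have : zetaA Fq A = m := by
    rw [zetaA]
    rw [tsum_congr fun d => Sd_eq Fq A (depth_pos Fq hw h2) d]
    exact hs.tsum_eq
  rw [this]
  exact hm

lemma le_CZ (N w : ℕ) (hw : 0 < w) :
    spLc (KNf Fq N) (LLw Fq) (· ≤ Fintype.card Fq) N w ≤ CZ Fq N w := by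
  apply Submodule.span_le.2
  rintro _ ⟨u, hu, hq, rfl⟩
  obtain ⟨h1, h2⟩ := pos_toA Fq hu
  refine Submodule.subset_span ⟨toA Fq u, h1, h2, ?_⟩
  rw [zetaA, tsum_congr fun d => Sd_eq Fq (toA Fq u) (depth_pos Fq hw h2) d, toW_toA,
    GG_congr _ (gt (cst Fq) (ell Fq)) u
      (fun x hx => zt_small (ellData Fq) (htrK Fq) x (hu.1 x hx).1 (hq x hx))]
  exact (GG_hasSum Fq hu.1 (word_pos Fq hw hu)).tsum_eq.symm

end fin


end part7

/-- **Strong Brown–Deligne theorem for cyclotomic MZV's** (Theorem `strong BD MZV`): the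
set `{Li(𝛆;𝔰) : 𝔰 ∈ S_w, 𝛆 ∈ Γ_N^{depth 𝔰}}` spans the `K_N`-vector space `CZ_{N,w}`. -/
theorem strong_brown_deligne_MZV
    (Fq : Type) [Field Fq] [Fintype Fq] (N w : ℕ) (hN : 0 < N) (hw : 0 < w) :
    Submodule.span (KNf Fq N) (Set.range fun A : SwIdx Fq N w => Li Fq A.1)
      = CZ Fq N w := by
  apply le_antisymm
  · refine le_trans ?_ ((spT_le Fq N w hN).trans (le_CZ Fq N w hw))
    apply Submodule.span_le.2
    rintro _ ⟨⟨A, h1, h0, h2, h3⟩, rfl⟩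
    exact Submodule.subset_span ⟨toW Fq A, isW_toW Fq h1 h2, (LLw_toW Fq A h1.1).symm⟩
  · refine (CZ_le Fq N w hw).trans ((spS_le Fq N w hN).trans ?_)
    apply Submodule.span_le.2
    rintro _ ⟨u, hu, hq, rfl⟩
    obtain ⟨h1, h2⟩ := pos_toA Fq hu
    exact Submodule.subset_span ⟨⟨toA Fq u, h1, depth_pos Fq hw h2, h2,
      fun i => hq _ (List.get_mem u i)⟩, rfl⟩

end ZHPC
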